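/- arXiv:1903.11310 — 3 statements merged into one kernel-verified Lean document; each statement's English description precedes it below -/
import Mathlib

section
/- Let w : ℝ → (0,∞) be continuous with 1/w not Lebesgue-integrable on (−∞,0) and not Lebesgue-integrable on (0,∞), and define for t ≥ 0 the operator T_w(t) on L²_w(ℝ) by (T_w(t)x)(ξ) = (w(ξ+μ_w(ξ,t))/w(ξ))·x(ξ+μ_w(ξ,t)). Let D(A_w) = {x ∈ L²_w(ℝ) : w·x has a locally absolutely continuous representative whose a.e. derivative (w·x)′ belongs to L²_w(ℝ)}. Then for x ∈ L²_w(ℝ): the limit lim_{t↓0} (T_w(t)x − x)/t exists in L²_w(ℝ) if and only if x ∈ D(A_w), and in that case the limit equals (w·x)′. (In other words, the generator of the C₀-semigroup (T_w(t))_{t≥0} is A_w x = (w·x)′ with domain D(A_w).) -/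
open MeasureTheory Filter Set Topology

/-- `p_w(ξ) = ∫₀^ξ w(ζ)⁻¹ dζ`. -/
noncomputable def pW (w : ℝ → ℝ) (ξ : ℝ) : ℝ := ∫ ζ in (0:ℝ)..ξ, (w ζ)⁻¹

/-- `μ_w(ξ,t) = p_w⁻¹(p_w(ξ) + t) − ξ`. -/
noncomputable def muW (w : ℝ → ℝ) (ξ t : ℝ) : ℝ :=
  Function.invFun (pW w) (pW w ξ + t) - ξ

/-- `(T_w(t)x)(ξ) = (w(ξ+μ_w(ξ,t))/w(ξ)) · x(ξ+μ_w(ξ,t))`. -/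
noncomputable def Tw (w : ℝ → ℝ) (t : ℝ) (x : ℝ → ℂ) (ξ : ℝ) : ℂ :=
  ((w (ξ + muW w ξ t) / w ξ : ℝ) : ℂ) * x (ξ + muW w ξ t)

open scoped ENNReal

section Translation

variable {E : Type*} [NormedAddCommGroup E]

theorem tendsto_eLpNorm_translate_sub {G : ℝ → E} (hG : MemLp G 2 volume) :
    Tendsto (fun r : ℝ => eLpNorm (fun s => G (s + r) - G s) 2 volume) (𝓝 0) (𝓝 0) := by
  have : Fact ((2 : ℝ≥0∞) ≠ ∞) := ⟨by norm_num⟩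
  have hcont : Continuous fun r : ℝ => DomAddAct.mk r +ᵥ hG.toLp G := by
    fun_prop
  have h0 : DomAddAct.mk (0 : ℝ) +ᵥ hG.toLp G = hG.toLp G := by simp
  have h := hcont.tendsto 0
  rw [h0, tendsto_iff_edist_tendsto_0] at h
  refine h.congr fun r => ?_
  rw [DomAddAct.mk_vadd_toLp, Lp.edist_toLp_toLp]
  refine eLpNorm_congr_ae (Eventually.of_forall fun s => ?_)
  simp [add_comm]

theorem eLpNorm_two_sq (f : ℝ → E) (μ : Measure ℝ) :
    eLpNorm f 2 μ ^ 2 = ∫⁻ x, ‖f x‖ₑ ^ 2 ∂μ := by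
  have := eLpNorm_nnreal_pow_eq_lintegral (f := f) (μ := μ) (p := 2) (by norm_num)
  norm_num at this
  simpa using this

theorem MeasureTheory.MemLp.comp_add_right_real {X : ℝ → E} (hX : MemLp X 2 volume) (t : ℝ) :
    MemLp (fun s => X (s + t)) 2 volume :=
  hX.comp_measurePreserving (measurePreserving_add_right volume t)

theorem MeasureTheory.MemLp.intervalIntegrable_two {G : ℝ → E} (hG : MemLp G 2 volume) (a b : ℝ) :
    IntervalIntegrable G volume a b :=
  intervalIntegrable_iff.2 <| ((MemLp.locallyIntegrable hG (by norm_num)).integrableOn_isCompact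
    isCompact_uIcc).mono_set uIoc_subset_uIcc

variable [NormedSpace ℝ E]

theorem enorm_setIntegral_le_eLpNorm_two {f : ℝ → E} (hf : AEStronglyMeasurable f volume)
    (s : Set ℝ) :
    ‖∫ x in s, f x‖ₑ ≤ eLpNorm f 2 (volume.restrict s) * volume s ^ (1 / 2 : ℝ) := by
  calc ‖∫ x in s, f x‖ₑ ≤ ∫⁻ x in s, ‖f x‖ₑ := enorm_integral_le_lintegral_enorm _
    _ = eLpNorm f 1 (volume.restrict s) := eLpNorm_one_eq_lintegral_enorm.symm
    _ ≤ _ := by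
      have := eLpNorm_le_eLpNorm_mul_rpow_measure_univ (p := 1) (q := 2) (by norm_num)
        (hf.restrict (s := s))
      convert this using 2
      rw [Measure.restrict_apply_univ]
      norm_num

theorem enorm_average_sq_le {f : ℝ → E} (hf : AEStronglyMeasurable f volume) {t : ℝ} (ht : 0 < t) :
    ‖t⁻¹ • ∫ r in 0..t, f r‖ₑ ^ 2 ≤ (ENNReal.ofReal t)⁻¹ * ∫⁻ r in Ioc 0 t, ‖f r‖ₑ ^ 2 := by
  have h1 : ENNReal.ofReal t ≠ 0 := by simpa using ht
  have h := enorm_setIntegral_le_eLpNorm_two hf (Ioc 0 t)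
  rw [intervalIntegral.integral_of_le ht.le, enorm_smul, mul_pow, ← eLpNorm_two_sq]
  have h2 : ‖t⁻¹‖ₑ = (ENNReal.ofReal t)⁻¹ := by
    rw [Real.enorm_eq_ofReal (by positivity), ENNReal.ofReal_inv_of_pos ht]
  rw [h2]
  calc (ENNReal.ofReal t)⁻¹ ^ 2 * ‖∫ r in Ioc 0 t, f r‖ₑ ^ 2
      ≤ (ENNReal.ofReal t)⁻¹ ^ 2 *
        (eLpNorm f 2 (volume.restrict (Ioc 0 t)) * volume (Ioc 0 t) ^ (1 / 2 : ℝ)) ^ 2 := by gcongr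
    _ = _ := by
      rw [Real.volume_Ioc, sub_zero, mul_pow, ← ENNReal.rpow_natCast (_ ^ (1 / 2 : ℝ)),
        ← ENNReal.rpow_mul]
      norm_num
      rw [mul_comm (eLpNorm _ _ _ ^ 2), ← mul_assoc, pow_two, mul_assoc (_⁻¹),
        ENNReal.inv_mul_cancel h1 (by simp), mul_one]

variable [CompleteSpace E]

theorem tendsto_eLpNorm_slope_of_eq_integral {X Y G : ℝ → E} (hG : MemLp G 2 volume)
    (hYX : Y =ᵐ[volume] X) (hY : ∀ a b : ℝ, Y b - Y a = ∫ s in a..b, G s) :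
    Tendsto (fun t : ℝ => eLpNorm (fun s => t⁻¹ • (X (s + t) - X s) - G s) 2 volume)
      (𝓝[>] 0) (𝓝 0) := by
  wlog hGm : StronglyMeasurable G generalizing G
  · have hae := hG.1.ae_eq_mk
    refine (this (hG.ae_eq hae) (fun a b => ?_) hG.1.stronglyMeasurable_mk).congr fun t => ?_
    · rw [hY, intervalIntegral.integral_congr_ae]
      filter_upwards [hae] with s hs _ using hs
    · refine eLpNorm_congr_ae ?_
      filter_upwards [hae] with s hs
      rw [hs]
  have key : ∀ t > 0, ∀ C : ℝ≥0∞,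
      (∀ r ∈ Ioc 0 t, eLpNorm (fun s => G (s + r) - G s) 2 volume ≤ C) →
      eLpNorm (fun s => t⁻¹ • (X (s + t) - X s) - G s) 2 volume ≤ C := by
    intro t ht C hC
    have h1 : (fun s => t⁻¹ • (X (s + t) - X s) - G s) =ᵐ[volume]
        fun s => t⁻¹ • ∫ r in 0..t, (G (s + r) - G s) := by
      have hsh := (measurePreserving_add_right volume t).quasiMeasurePreserving.ae_eq_comp hYX
      filter_upwards [hYX, hsh] with s hs hst
      simp only [Function.comp_apply] at hst
      rw [← hs, ← hst, hY, intervalIntegral.integral_sub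
        (((hG.intervalIntegrable_two s (s + t)).comp_add_left s).mono_set (by simp)) (by simp)]
      rw [intervalIntegral.integral_comp_add_left, intervalIntegral.integral_const, smul_sub,
        smul_smul]
      simp [ht.ne']
    have hmeas : StronglyMeasurable fun p : ℝ × ℝ => G (p.1 + p.2) - G p.1 :=
      (hGm.comp_measurable (by fun_prop)).sub (hGm.comp_measurable (by fun_prop))
    rw [eLpNorm_congr_ae h1, ← ENNReal.pow_le_pow_left_iff (n := 2) (by norm_num), eLpNorm_two_sq]
    have h0 : ENNReal.ofReal t ≠ 0 := by simpa using ht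
    calc ∫⁻ s, ‖t⁻¹ • ∫ r in 0..t, (G (s + r) - G s)‖ₑ ^ 2
        ≤ ∫⁻ s, (ENNReal.ofReal t)⁻¹ * ∫⁻ r in Ioc 0 t, ‖G (s + r) - G s‖ₑ ^ 2 :=
          lintegral_mono fun s => enorm_average_sq_le
            (hmeas.comp_measurable (measurable_prodMk_left (x := s))).aestronglyMeasurable ht
      _ = (ENNReal.ofReal t)⁻¹ * ∫⁻ r in Ioc 0 t, ∫⁻ s, ‖G (s + r) - G s‖ₑ ^ 2 := by
          rw [lintegral_const_mul' _ _ (by simpa using ht), lintegral_lintegral_swap]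
          exact (hmeas.enorm.pow_const 2).aemeasurable
      _ ≤ (ENNReal.ofReal t)⁻¹ * ∫⁻ r in Ioc 0 t, C ^ 2 := by
          refine mul_le_mul' le_rfl (setLIntegral_mono measurable_const fun r hr => ?_)
          rw [← eLpNorm_two_sq (fun s => G (s + r) - G s)]
          gcongr
          exact hC r hr
      _ = C ^ 2 := by
          rw [setLIntegral_const, Real.volume_Ioc, sub_zero, mul_comm (C ^ 2), ← mul_assoc,
            ENNReal.inv_mul_cancel h0 (by simp), one_mul]
  rw [ENNReal.tendsto_nhds_zero]
  intro ε hε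
  have h := ENNReal.tendsto_nhds_zero.1 (tendsto_eLpNorm_translate_sub hG) ε hε
  obtain ⟨δ, hδ, hball⟩ := Metric.eventually_nhds_iff.1 h
  filter_upwards [Ioo_mem_nhdsGT hδ] with t ht
  refine key t ht.1 ε fun r hr => hball ?_
  rw [Real.dist_eq, sub_zero, abs_of_pos hr.1]
  exact hr.2.trans_lt ht.2

theorem exists_ae_eq_integral_of_tendsto_eLpNorm_slope {X G : ℝ → E}
    (hX : MemLp X 2 volume) (hG : MemLp G 2 volume)
    (h : Tendsto (fun t : ℝ => eLpNorm (fun s => t⁻¹ • (X (s + t) - X s) - G s) 2 volume)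
      (𝓝[>] 0) (𝓝 0)) :
    ∃ Y : ℝ → E, Y =ᵐ[volume] X ∧ ∀ a b : ℝ, Y b - Y a = ∫ s in a..b, G s := by
  have hLDT := LocallyIntegrable.ae_hasDerivAt_integral (hX.locallyIntegrable (by norm_num))
  have hXi := hX.intervalIntegrable_two
  have hGi := hG.intervalIntegrable_two
  have hdiff : ∀ a b : ℝ, HasDerivAt (fun u => ∫ s in 0..u, X s) (X a) a →
      HasDerivAt (fun u => ∫ s in 0..u, X s) (X b) b → X b - X a = ∫ s in a..b, G s := by
    intro a b ha hb
    have hlim0 : Tendsto (fun t : ℝ => ∫ s in a..b, (t⁻¹ • (X (s + t) - X s) - G s))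
        (𝓝[>] 0) (𝓝 0) := by
      rw [tendsto_zero_iff_enorm_tendsto_zero]
      have hmul := ENNReal.Tendsto.mul_const (b := volume (uIoc a b) ^ (1 / 2 : ℝ)) h
        (Or.inr (by simp [uIoc]))
      rw [zero_mul] at hmul
      refine tendsto_of_tendsto_of_tendsto_of_le_of_le tendsto_const_nhds hmul
        (fun _ => zero_le) fun t => ?_
      have hm : AEStronglyMeasurable (fun s => t⁻¹ • (X (s + t) - X s) - G s) volume :=
        ((((hX.comp_add_right_real t).sub hX).const_smul t⁻¹).sub hG).1
      simp only
      rw [← ofReal_norm, intervalIntegral.norm_intervalIntegral_eq, ofReal_norm]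
      refine (enorm_setIntegral_le_eLpNorm_two hm _).trans ?_
      gcongr
      exact Measure.restrict_le_self
    have hlim1 : Tendsto (fun t : ℝ => ∫ s in a..b, (t⁻¹ • (X (s + t) - X s) - G s))
        (𝓝[>] 0) (𝓝 (X b - X a - ∫ s in a..b, G s)) := by
      have hbt := (hasDerivAt_iff_tendsto_slope_zero.1 hb).mono_left
        (nhdsWithin_mono 0 fun t (ht : 0 < t) => ht.ne')
      have hat := (hasDerivAt_iff_tendsto_slope_zero.1 ha).mono_left
        (nhdsWithin_mono 0 fun t (ht : 0 < t) => ht.ne')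
      refine ((hbt.sub hat).sub_const (∫ s in a..b, G s)).congr fun t => ?_
      have hXt := (hX.comp_add_right_real t).intervalIntegrable_two a b
      rw [intervalIntegral.integral_sub (f := fun s => t⁻¹ • (X (s + t) - X s))
          ((hXt.sub (hXi a b)).smul t⁻¹) (hGi a b),
        intervalIntegral.integral_smul, intervalIntegral.integral_sub hXt (hXi a b),
        intervalIntegral.integral_comp_add_right, ← smul_sub,
        ← intervalIntegral.integral_interval_sub_left (hXi 0 (b + t)) (hXi 0 (a + t)),
        ← intervalIntegral.integral_interval_sub_left (hXi 0 b) (hXi 0 a)]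
      congr 2
      abel
    exact sub_eq_zero.1 (tendsto_nhds_unique hlim1 hlim0)
  obtain ⟨a₀, ha₀⟩ := hLDT.exists
  refine ⟨fun s => X a₀ + ∫ r in a₀..s, G r, ?_, fun a b => ?_⟩
  · filter_upwards [hLDT] with s hs
    rw [← hdiff a₀ s (ha₀ 0) (hs 0)]
    abel
  · rw [add_sub_add_left_eq_sub, intervalIntegral.integral_interval_sub_left (hGi _ _) (hGi _ _)]

end Translation

section ChangeOfVariables

variable {w : ℝ → ℝ}

theorem hasDerivAt_pW (hw : Continuous w) (hpos : ∀ ξ, 0 < w ξ) (ξ : ℝ) :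
    HasDerivAt (pW w) (w ξ)⁻¹ ξ :=
  (hw.inv₀ fun ξ => (hpos ξ).ne').integral_hasStrictDerivAt 0 ξ |>.hasDerivAt

theorem strictMono_pW (hw : Continuous w) (hpos : ∀ ξ, 0 < w ξ) : StrictMono (pW w) :=
  strictMono_of_hasDerivAt_pos (hasDerivAt_pW hw hpos) fun ξ => inv_pos.2 (hpos ξ)

theorem surjective_pW (hw : Continuous w) (hpos : ∀ ξ, 0 < w ξ)
    (hni_neg : ¬ IntegrableOn (fun ζ => (w ζ)⁻¹) (Set.Iio 0))
    (hni_pos : ¬ IntegrableOn (fun ζ => (w ζ)⁻¹) (Set.Ioi 0)) :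
    Function.Surjective (pW w) := by
  have hinv : Continuous fun ζ => (w ζ)⁻¹ := hw.inv₀ fun ξ => (hpos ξ).ne'
  have hnorm : ∀ ζ, ‖(w ζ)⁻¹‖ = (w ζ)⁻¹ := fun ζ =>
    Real.norm_of_nonneg (inv_pos.2 (hpos ζ)).le
  have hP : Continuous (pW w) :=
    continuous_iff_continuousAt.2 fun ξ => (hasDerivAt_pW hw hpos ξ).continuousAt
  intro c
  refine mem_range_of_exists_le_of_exists_ge hP ?_ ?_
  · by_contra! h
    refine hni_neg ((integrableOn_Iic_of_intervalIntegral_norm_bounded (-c) 0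
      (fun i => hinv.integrableOn_Ioc) tendsto_id ?_).mono_set Iio_subset_Iic_self)
    refine Eventually.of_forall fun i => ?_
    simp only [hnorm, id]
    rw [intervalIntegral.integral_symm]
    exact neg_le_neg (h i).le
  · by_contra! h
    refine hni_pos (integrableOn_Ioi_of_intervalIntegral_norm_bounded c 0
      (fun i => hinv.integrableOn_Ioc) tendsto_id ?_)
    refine Eventually.of_forall fun i => ?_
    simp only [hnorm, id]
    exact (h i).le

theorem hasDerivAt_invFun_pW (hw : Continuous w) (hpos : ∀ ξ, 0 < w ξ)
    (hsurj : Function.Surjective (pW w)) (s : ℝ) :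
    HasDerivAt (Function.invFun (pW w)) (w (Function.invFun (pW w) s)) s := by
  have hmono := strictMono_pW hw hpos
  have hr := Function.rightInverse_invFun hsurj
  have hq : Continuous (Function.invFun (pW w)) := by
    refine Monotone.continuous_of_surjective (fun a b hab => ?_)
      (Function.invFun_surjective hmono.injective)
    rwa [← hmono.le_iff_le, hr, hr]
  have := HasDerivAt.of_local_left_inverse hq.continuousAt
    (hasDerivAt_pW hw hpos (Function.invFun (pW w) s)) (inv_pos.2 (hpos _)).ne'
    (Eventually.of_forall hr)
  rwa [inv_inv] at this

variable {q : ℝ → ℝ}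

theorem integral_eq_integral_comp_of_bijective {F : Type*} [NormedAddCommGroup F] [NormedSpace ℝ F]
    (hpos : ∀ ξ, 0 < w ξ) (hq : ∀ s, HasDerivAt q (w (q s)) s) (hbij : Function.Bijective q)
    (f : ℝ → F) : ∫ ξ, f ξ = ∫ s, w (q s) • f (q s) := by
  have := integral_image_eq_integral_abs_deriv_smul MeasurableSet.univ
    (fun s _ => (hq s).hasDerivWithinAt) hbij.injective.injOn f
  simpa [hbij.surjective.range_eq, abs_of_pos (hpos _)] using this

theorem integrable_comp_of_bijective {F : Type*} [NormedAddCommGroup F] [NormedSpace ℝ F]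
    (hpos : ∀ ξ, 0 < w ξ) (hq : ∀ s, HasDerivAt q (w (q s)) s) (hbij : Function.Bijective q)
    {f : ℝ → F} (hf : Integrable f) : Integrable fun s => w (q s) • f (q s) := by
  have := integrableOn_image_iff_integrableOn_abs_deriv_smul MeasurableSet.univ
    (fun s _ => (hq s).hasDerivWithinAt) hbij.injective.injOn f
  simp only [image_univ, hbij.surjective.range_eq, abs_of_pos (hpos _), integrableOn_univ] at this
  exact this.1 hf

theorem intervalIntegral_eq_intervalIntegral_comp {F : Type*} [NormedAddCommGroup F]
    [NormedSpace ℝ F] (hpos : ∀ ξ, 0 < w ξ) (hq : ∀ s, HasDerivAt q (w (q s)) s)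
    (f : ℝ → F) (a b : ℝ) : ∫ ξ in q a..q b, f ξ = ∫ s in a..b, w (q s) • f (q s) := by
  have hmono : StrictMono q := strictMono_of_hasDerivAt_pos hq fun s => hpos _
  wlog hab : a ≤ b generalizing a b
  · rw [intervalIntegral.integral_symm, this b a (le_of_not_ge hab),
      ← intervalIntegral.integral_symm]
  rw [intervalIntegral.integral_of_le (hmono.monotone hab), intervalIntegral.integral_of_le hab,
    ← integral_Icc_eq_integral_Ioc, ← integral_Icc_eq_integral_Ioc]
  exact (integral_Icc_deriv_smul_of_deriv_nonneg (fun s _ => (hq s).continuousAt.continuousWithinAt)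
    (fun s _ => hq s) (fun s _ => (hpos _).le) hab).symm

theorem quasiMeasurePreserving_of_rightInverse {p : ℝ → ℝ} (hp : Differentiable ℝ p)
    (hq : Measurable q) (hpq : Function.LeftInverse p q) :
    Measure.QuasiMeasurePreserving q volume volume := by
  refine ⟨hq, Measure.AbsolutelyContinuous.mk fun s hs h0 => ?_⟩
  rw [Measure.map_apply hq hs]
  exact measure_mono_null (t := p '' s) (fun t ht => ⟨q t, ht, hpq t⟩)
    (addHaar_image_eq_zero_of_differentiableOn_of_addHaar_eq_zero volume
      hp.differentiableOn h0)

theorem memLp_two_mul_comp (hw : Continuous w) (hpos : ∀ ξ, 0 < w ξ)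
    (hq : ∀ s, HasDerivAt q (w (q s)) s) (hbij : Function.Bijective q)
    (hqm : Measure.QuasiMeasurePreserving q volume volume) {x : ℝ → ℂ}
    (hxm : AEStronglyMeasurable x volume) (hx : Integrable fun ξ => w ξ * ‖x ξ‖ ^ 2) :
    MemLp (fun s => (w (q s) : ℂ) * x (q s)) 2 volume := by
  have hqc : Continuous q := continuous_iff_continuousAt.2 fun s => (hq s).continuousAt
  have hm : AEStronglyMeasurable (fun s => (w (q s) : ℂ) * x (q s)) volume :=
    (Complex.continuous_ofReal.comp (hw.comp hqc)).aestronglyMeasurable.mul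
      (hxm.comp_quasiMeasurePreserving hqm)
  rw [memLp_two_iff_integrable_sq_norm hm]
  refine (integrable_comp_of_bijective hpos hq hbij hx).congr (Eventually.of_forall fun s => ?_)
  simp only [smul_eq_mul, norm_mul, Complex.norm_real, Real.norm_of_nonneg (hpos _).le]
  ring

theorem integral_norm_sq_eq_toReal_eLpNorm_sq {f : ℝ → ℂ} (hf : MemLp f 2 volume) :
    ∫ s, ‖f s‖ ^ 2 = (eLpNorm f 2 volume).toReal ^ 2 := by
  rw [hf.eLpNorm_eq_integral_rpow_norm (by norm_num) (by norm_num),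
    ENNReal.toReal_ofReal (by positivity), ← Real.rpow_natCast (_ ^ _),
    ← Real.rpow_mul (by positivity)]
  norm_num

theorem tendsto_integral_norm_sq_iff {ι : Type*} {l : Filter ι} {f : ι → ℝ → ℂ}
    (hf : ∀ i, MemLp (f i) 2 volume) :
    Tendsto (fun i => ∫ s, ‖f i s‖ ^ 2) l (𝓝 0) ↔
      Tendsto (fun i => eLpNorm (f i) 2 volume) l (𝓝 0) := by
  simp only [integral_norm_sq_eq_toReal_eLpNorm_sq (hf _)]
  rw [← ENNReal.tendsto_toReal_iff (fun i => (hf i).2.ne) ENNReal.zero_ne_top, ENNReal.toReal_zero]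
  refine ⟨fun h => ?_, fun h => by simpa using h.pow 2⟩
  simpa [Real.sqrt_sq] using h.sqrt

end ChangeOfVariables

/-- The strong `L²_w`-limit of `(T_w(t)x − x)/t` as `t ↓ 0` exists and equals `g`
if and only if `w·x` has a locally absolutely continuous representative `y`
whose a.e. derivative is `g` (encoded via the fundamental theorem of calculus),
where `g` ranges over elements of `L²_w(ℝ)`. -/
theorem stmt_13 (w : ℝ → ℝ) (hw_cont : Continuous w) (hw_pos : ∀ ξ, 0 < w ξ)
    (hni_neg : ¬ IntegrableOn (fun ζ => (w ζ)⁻¹) (Set.Iio 0))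
    (hni_pos : ¬ IntegrableOn (fun ζ => (w ζ)⁻¹) (Set.Ioi 0))
    (x : ℝ → ℂ) (hx_meas : AEStronglyMeasurable x volume)
    (hx : Integrable fun ξ => w ξ * ‖x ξ‖ ^ 2) :
    ∀ g : ℝ → ℂ, AEStronglyMeasurable g volume →
      (Integrable fun ξ => w ξ * ‖g ξ‖ ^ 2) →
      (Tendsto (fun t : ℝ => ∫ ξ, w ξ * ‖(Tw w t x ξ - x ξ) / (t : ℂ) - g ξ‖ ^ 2)
          (𝓝[>] (0:ℝ)) (𝓝 0)
        ↔ ∃ y : ℝ → ℂ,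
            (∀ᵐ ξ, y ξ = (w ξ : ℂ) * x ξ) ∧
            ∀ a b : ℝ, y b - y a = ∫ ζ in a..b, g ζ) := by
  intro g hg_meas hg
  set q := Function.invFun (pW w)
  have hmono := strictMono_pW hw_cont hw_pos
  have hsurj := surjective_pW hw_cont hw_pos hni_neg hni_pos
  have hPq : Function.LeftInverse (pW w) q := Function.rightInverse_invFun hsurj
  have hqP : Function.LeftInverse q (pW w) := Function.leftInverse_invFun hmono.injective
  have hq : ∀ s, HasDerivAt q (w (q s)) s := hasDerivAt_invFun_pW hw_cont hw_pos hsurj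
  have hbij : Function.Bijective q := ⟨hPq.injective, hqP.surjective⟩
  have hqc : Continuous q := continuous_iff_continuousAt.2 fun s => (hq s).continuousAt
  have hPdiff : Differentiable ℝ (pW w) := fun ξ =>
    (hasDerivAt_pW hw_cont hw_pos ξ).differentiableAt
  have hqm := quasiMeasurePreserving_of_rightInverse hPdiff hqc.measurable hPq
  have hPm := quasiMeasurePreserving_of_rightInverse (fun s => (hq s).differentiableAt)
    hPdiff.continuous.measurable hqP
  have hX := memLp_two_mul_comp hw_cont hw_pos hq hbij hqm hx_meas hx
  have hG := memLp_two_mul_comp hw_cont hw_pos hq hbij hqm hg_meas hg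
  set X : ℝ → ℂ := fun s => (w (q s) : ℂ) * x (q s) with hX_def
  set G : ℝ → ℂ := fun s => (w (q s) : ℂ) * g (q s) with hG_def
  have hslope : ∀ t : ℝ, ∫ ξ, w ξ * ‖(Tw w t x ξ - x ξ) / (t : ℂ) - g ξ‖ ^ 2 =
      ∫ s, ‖t⁻¹ • (X (s + t) - X s) - G s‖ ^ 2 := by
    intro t
    rw [integral_eq_integral_comp_of_bijective hw_pos hq hbij]
    refine integral_congr_ae (Eventually.of_forall fun s => ?_)
    have hw0 : (w (q s) : ℂ) ≠ 0 := Complex.ofReal_ne_zero.2 (hw_pos _).ne'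
    have hshift : q s + muW w (q s) t = q (s + t) := by
      rw [muW, hPq s, add_sub_cancel]
    have hfac : t⁻¹ • (X (s + t) - X s) - G s =
        (w (q s) : ℂ) * ((Tw w t x (q s) - x (q s)) / (t : ℂ) - g (q s)) := by
      rw [Tw, hshift, hX_def, hG_def, Complex.real_smul]
      push_cast
      field_simp
    simp only [hfac, smul_eq_mul, norm_mul, Complex.norm_real,
      Real.norm_of_nonneg (hw_pos _).le]
    ring
  simp only [hslope]
  rw [tendsto_integral_norm_sq_iff (f := fun t s => t⁻¹ • (X (s + t) - X s) - G s)
    fun t => (((hX.comp_add_right_real t).sub hX).const_smul t⁻¹).sub hG]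
  have hint : ∀ a b : ℝ, ∫ ξ in q a..q b, g ξ = ∫ s in a..b, G s := fun a b => by
    rw [intervalIntegral_eq_intervalIntegral_comp hw_pos hq]
    simp only [hG_def, Complex.real_smul]
  constructor
  · intro h
    obtain ⟨Y, hYX, hY⟩ := exists_ae_eq_integral_of_tendsto_eLpNorm_slope hX hG h
    refine ⟨Y ∘ pW w, ?_, fun a b => ?_⟩
    · filter_upwards [hPm.ae_eq_comp hYX] with ξ hξ
      simpa [hX_def, hqP ξ] using hξ
    · rw [Function.comp_apply, Function.comp_apply, hY, ← hint, hqP, hqP]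
  · rintro ⟨y, hyx, hy⟩
    refine tendsto_eLpNorm_slope_of_eq_integral (Y := y ∘ q) hG (hqm.ae_eq_comp hyx) fun a b => ?_
    rw [← hint, ← hy, Function.comp_apply, Function.comp_apply]
end

section
/- Let θ : [0,∞) → (−∞,0) be continuous with 1/θ not Lebesgue-integrable on (0,∞). Let p_θ(ξ) = ∫₀^ξ θ(ζ)⁻¹ dζ, a strictly decreasing bijection of [0,∞) onto (−∞,0], with inverse p_θ⁻¹ : (−∞,0] → [0,∞), and for ξ ≥ 0, t ≥ 0 with p_θ(ξ)+t ≤ 0 set μ_θ(ξ,t) = p_θ⁻¹(p_θ(ξ)+t) − ξ. Define for t ≥ 0 the operator T_θ(t) on L²_{|θ|}(0,∞) by (T_θ(t)x)(ξ) = (θ(ξ+μ_θ(ξ,t))/θ(ξ))·x(ξ+μ_θ(ξ,t)) when p_θ(ξ)+t ≤ 0 (equivalently ξ+μ_θ(ξ,t) ≥ 0), and (T_θ(t)x)(ξ) = 0 otherwise. Then: (a) each T_θ(t) is a well-defined linear contraction of L²_{|θ|}(0,∞); (b) T_θ(0) = id and T_θ(t)∘T_θ(s) = T_θ(t+s) for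 all s, t ≥ 0; (c) t ↦ T_θ(t)x is continuous on [0,∞) for each x; and (d) for x ∈ L²_{|θ|}(0,∞), the limit lim_{t↓0}(T_θ(t)x − x)/t exists in L²_{|θ|}(0,∞) if and only if θ·x has a locally absolutely continuous representative y on [0,∞) with y(0) = 0 and y′ ∈ L²_{|θ|}(0,∞), and in that case the limit equals (θ·x)′. (That is, (T_θ(t))_{t≥0} is a C₀-semigroup with generator A_θ x = (θ·x)′ on D(A_θ) = {x : θ·x ∈ AC_loc[0,∞), (θ·x)′ ∈ L²_{|θ|}(0,∞), (θ·x)(0) = 0}.) -/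
open MeasureTheory Filter Set Topology

theorem eLpNorm_two_sq_s16 {α : Type*} [MeasurableSpace α] (μ : Measure α) (h : α → ℂ) :
    eLpNorm h 2 μ ^ 2 = ∫⁻ s, ‖h s‖ₑ ^ 2 ∂μ := by
  have := eLpNorm_nnreal_pow_eq_lintegral (f := h) (μ := μ) (p := 2) (by norm_num)
  simpa only [NNReal.coe_ofNat, ENNReal.coe_ofNat, ← ENNReal.rpow_natCast, Nat.cast_ofNat] using this

theorem enorm_integral_sq_le {α : Type*} [MeasurableSpace α] (μ : Measure α) {h : α → ℂ}
    (hh : AEStronglyMeasurable h μ) :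
    ‖∫ s, h s ∂μ‖ₑ ^ 2 ≤ μ univ * ∫⁻ s, ‖h s‖ₑ ^ 2 ∂μ := by
  have h1 : ‖∫ s, h s ∂μ‖ₑ ≤ eLpNorm h 2 μ * μ univ ^ (1 / 2 : ℝ) := by
    refine (enorm_integral_le_lintegral_enorm h).trans ?_
    rw [← eLpNorm_one_eq_lintegral_enorm]
    have := eLpNorm_le_eLpNorm_mul_rpow_measure_univ (p := 1) (q := 2) (by norm_num) hh
    norm_num at this ⊢
    exact this
  calc ‖∫ s, h s ∂μ‖ₑ ^ 2 ≤ (eLpNorm h 2 μ * μ univ ^ (1 / 2 : ℝ)) ^ 2 := by gcongr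
    _ = μ univ * ∫⁻ s, ‖h s‖ₑ ^ 2 ∂μ := by
      rw [mul_pow, eLpNorm_two_sq_s16, mul_comm, ← ENNReal.rpow_natCast, ← ENNReal.rpow_mul]
      norm_num

theorem integral_norm_sq_eq_toReal {α : Type*} [MeasurableSpace α] {μ : Measure α} {h : α → ℂ}
    (hh : AEStronglyMeasurable h μ) :
    ∫ s, ‖h s‖ ^ 2 ∂μ = (∫⁻ s, ‖h s‖ₑ ^ 2 ∂μ).toReal := by
  rw [integral_eq_lintegral_of_nonneg_ae (ae_of_all _ fun s => by positivity)
    (by simpa only [Pi.pow_def] using hh.norm.pow 2)]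
  congr 1
  refine lintegral_congr fun s => ?_
  rw [ENNReal.ofReal_pow (norm_nonneg _), ofReal_norm]

theorem tendsto_lintegral_translate_sub {f : ℝ → ℂ} (hf : MemLp f 2 volume) :
    Tendsto (fun t : ℝ => ∫⁻ s, ‖f (s - t) - f s‖ₑ ^ 2) (𝓝 0) (𝓝 0) := by
  have : Fact ((2 : ENNReal) ≠ ⊤) := ⟨by norm_num⟩
  have hc : Continuous fun t : ℝ => DomAddAct.mk (-t) +ᵥ hf.toLp f := by
    have : Continuous fun t : ℝ => DomAddAct.mk (-t) :=
      DomAddAct.continuous_mk.comp continuous_neg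
    exact this.vadd continuous_const
  have h1 : ∀ t : ℝ, ∫⁻ s, ‖f (s - t) - f s‖ₑ ^ 2 =
      edist (DomAddAct.mk (-t) +ᵥ hf.toLp f) (DomAddAct.mk (-0 : ℝ) +ᵥ hf.toLp f) ^ 2 := by
    intro t
    rw [DomAddAct.mk_vadd_toLp, DomAddAct.mk_vadd_toLp, Lp.edist_toLp_toLp, eLpNorm_two_sq_s16]
    refine lintegral_congr fun s => ?_
    simp [sub_eq_neg_add]
  simp_rw [h1]
  have h2 := ((hc.tendsto 0).edist (tendsto_const_nhds (x := DomAddAct.mk (-0 : ℝ) +ᵥ hf.toLp f)))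
  have h3 := ENNReal.Tendsto.pow (n := 2) h2
  simpa using h3

theorem enorm_intervalIntegral_sq_le {h : ℝ → ℂ} (hh : AEStronglyMeasurable h volume) {a b : ℝ}
    (hab : a ≤ b) :
    ‖∫ s in a..b, h s‖ₑ ^ 2 ≤ ENNReal.ofReal (b - a) * ∫⁻ s in Ioc a b, ‖h s‖ₑ ^ 2 := by
  rw [intervalIntegral.integral_of_le hab]
  simpa using enorm_integral_sq_le (volume.restrict (Ioc a b)) hh.restrict

theorem integral_eq_zero_of_neg {V : ℝ → ℂ} (hV0 : ∀ s < 0, V s = 0) {s : ℝ} (hs : s ≤ 0) :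
    ∫ r in (0 : ℝ)..s, V r = 0 := by
  rw [intervalIntegral.integral_symm, intervalIntegral.integral_of_le hs, neg_eq_zero,
    integral_Ioc_eq_integral_Ioo]
  exact setIntegral_eq_zero_of_forall_eq_zero fun x hx => hV0 x hx.2

theorem ae_eq_neg_integral_of_tendsto_translate {U V : ℝ → ℂ} (hU : MemLp U 2 volume)
    (hV : MemLp V 2 volume) (hU0 : ∀ s < 0, U s = 0)
    (h : Tendsto (fun t : ℝ => ∫⁻ s, ‖(U (s - t) - U s) / (t : ℂ) - V s‖ₑ ^ 2)
      (𝓝[>] (0 : ℝ)) (𝓝 0)) :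
    ∀ᵐ s : ℝ, 0 ≤ s → U s = -∫ r in (0 : ℝ)..s, V r := by
  have hUl : LocallyIntegrable U volume := hU.locallyIntegrable (by norm_num)
  have hVl : LocallyIntegrable V volume := hV.locallyIntegrable (by norm_num)
  have hUi : ∀ a b, IntervalIntegrable U volume a b := fun a b =>
    (hUl.integrableOn_isCompact isCompact_uIcc).intervalIntegrable
  have hVi : ∀ a b, IntervalIntegrable V volume a b := fun a b =>
    (hVl.integrableOn_isCompact isCompact_uIcc).intervalIntegrable
  have hUm (t : ℝ) : AEStronglyMeasurable (fun s => U (s - t)) volume :=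
    hU.1.comp_measurePreserving (measurePreserving_sub_right volume t)
  filter_upwards [LocallyIntegrable.ae_hasDerivAt_integral hUl] with b hb hb0
  have hd := hb 0
  set Φ : ℝ → ℂ := fun x => ∫ r in (0 : ℝ)..x, U r with hΦ
  have h1 : ∀ t : ℝ, 0 < t → ∫ s in (0 : ℝ)..b, ((U (s - t) - U s) / (t : ℂ) - V s) =
      t⁻¹ • (Φ (b - (0 + t)) - Φ (b - 0)) - ∫ r in (0 : ℝ)..b, V r := by
    intro t ht
    have hUt : IntervalIntegrable (fun s => U (s - t)) volume 0 b := by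
      simpa using (hUi (0 - t) (b - t)).comp_sub_right t
    rw [intervalIntegral.integral_sub ((hUt.sub (hUi _ _)).div_const _) (hVi _ _),
      intervalIntegral.integral_div, intervalIntegral.integral_sub hUt (hUi _ _),
      intervalIntegral.integral_comp_sub_right]
    have h2 : ∫ x in (0 - t)..(b - t), U x = Φ (b - t) := by
      rw [← intervalIntegral.integral_interval_sub_left (hUi 0 (b - t)) (hUi 0 (0 - t)),
        integral_eq_zero_of_neg hU0 (by linarith : 0 - t ≤ 0), sub_zero]
    rw [h2]
    simp [hΦ, div_eq_inv_mul]
  have h2 : HasDerivAt (fun t => Φ (b - t)) (-U b) 0 := by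
    have : HasDerivAt Φ (U b) (b - 0) := by simpa using hd
    simpa using this.comp_const_sub b 0
  have h3 : Tendsto (fun t : ℝ => ∫ s in (0 : ℝ)..b, ((U (s - t) - U s) / (t : ℂ) - V s))
      (𝓝[>] (0 : ℝ)) (𝓝 (-U b - ∫ r in (0 : ℝ)..b, V r)) := by
    have h4 := (hasDerivAt_iff_tendsto_slope_zero.1 h2).mono_left
      (nhdsWithin_mono (0 : ℝ) (fun x (hx : 0 < x) => hx.ne'))
    refine (h4.sub_const (∫ r in (0 : ℝ)..b, V r)).congr' ?_
    filter_upwards [self_mem_nhdsWithin] with t ht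
    exact (h1 t ht).symm
  have h5 : Tendsto (fun t : ℝ => ‖∫ s in (0 : ℝ)..b, ((U (s - t) - U s) / (t : ℂ) - V s)‖ₑ ^ 2)
      (𝓝[>] (0 : ℝ)) (𝓝 0) := by
    have h6 := ENNReal.Tendsto.const_mul (a := ENNReal.ofReal (b - 0)) h (Or.inr (by simp))
    rw [mul_zero] at h6
    refine tendsto_of_tendsto_of_tendsto_of_le_of_le tendsto_const_nhds h6 (fun _ => zero_le) ?_
    intro t
    refine (enorm_intervalIntegral_sq_le ?_ hb0).trans ?_
    · exact (((hUm t).sub hU.1).mul_const ((t : ℂ)⁻¹)).sub hV.1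
    · exact mul_le_mul_right (setLIntegral_le_lintegral _ _) _
  have h7 := ENNReal.Tendsto.pow (n := 2) (h3.enorm)
  have h8 := tendsto_nhds_unique h7 h5
  have h9 : -U b - ∫ r in (0 : ℝ)..b, V r = 0 := by simpa using h8
  linear_combination -h9

theorem tendsto_translate_of_ae_eq_neg_integral {U V : ℝ → ℂ}
    (hV : MemLp V 2 volume) (hU0 : ∀ s < 0, U s = 0) (hV0 : ∀ s < 0, V s = 0)
    (h : ∀ᵐ s : ℝ, 0 ≤ s → U s = -∫ r in (0 : ℝ)..s, V r) :
    Tendsto (fun t : ℝ => ∫⁻ s, ‖(U (s - t) - U s) / (t : ℂ) - V s‖ₑ ^ 2)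
      (𝓝[>] (0 : ℝ)) (𝓝 0) := by
  have hVl : LocallyIntegrable V volume := hV.locallyIntegrable (by norm_num)
  have hVi : ∀ a b, IntervalIntegrable V volume a b := fun a b =>
    (hVl.integrableOn_isCompact isCompact_uIcc).intervalIntegrable
  have hUV : ∀ᵐ s : ℝ, U s = -∫ r in (0 : ℝ)..s, V r := by
    filter_upwards [h] with s hs
    rcases le_or_gt 0 s with h0 | h0
    · exact hs h0
    · rw [hU0 s h0, integral_eq_zero_of_neg hV0 h0.le, neg_zero]
  have hVm' (t : ℝ) : AEStronglyMeasurable (fun s => V (t - s)) volume :=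
    hV.1.comp_measurePreserving (Measure.measurePreserving_sub_left volume t)
  have key : ∀ t : ℝ, 0 < t → ∫⁻ s, ‖(U (s - t) - U s) / (t : ℂ) - V s‖ₑ ^ 2 ≤
      (ENNReal.ofReal t)⁻¹ * ∫⁻ r in Ioc 0 t, ∫⁻ s, ‖V (s - r) - V s‖ₑ ^ 2 := by
    intro t ht
    have hUV' := (measurePreserving_sub_right volume t).quasiMeasurePreserving.ae hUV
    have hm : AEMeasurable (fun z : ℝ × ℝ => ‖V (z.1 - z.2) - V z.1‖ₑ ^ 2)
        (volume.prod (volume.restrict (Ioc 0 t))) := by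
      have hm0 : AEStronglyMeasurable (fun z : ℝ × ℝ => V (z.1 - z.2) - V z.1)
          (volume.prod volume) := by
        refine AEStronglyMeasurable.sub ?_ ?_
        · exact hV.1.comp_quasiMeasurePreserving
            (quasiMeasurePreserving_sub_of_right_invariant volume volume)
        · exact hV.1.comp_quasiMeasurePreserving Measure.quasiMeasurePreserving_fst
      exact (hm0.mono_measure
        (Measure.prod_mono le_rfl Measure.restrict_le_self)).enorm.pow_const 2
    rw [← lintegral_lintegral_swap hm, ← lintegral_const_mul'' _ hm.lintegral_prod_right']
    refine lintegral_mono_ae ?_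
    filter_upwards [hUV, hUV'] with s hs hs'
    have h1 : (U (s - t) - U s) / (t : ℂ) - V s =
        (t : ℂ)⁻¹ * ∫ r in (0 : ℝ)..t, (V (s - r) - V s) := by
      have hi : IntervalIntegrable (fun r => V (s - r)) volume 0 t := by
        simpa using ((hVi (s - 0) (s - t)).comp_sub_left s)
      rw [intervalIntegral.integral_sub hi (by simp), intervalIntegral.integral_comp_sub_left,
        intervalIntegral.integral_const, hs, hs',
        ← intervalIntegral.integral_interval_sub_left (hVi 0 (s - 0)) (hVi 0 (s - t))]
      have : (t : ℂ) ≠ 0 := by exact_mod_cast ht.ne'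
      simp
      field_simp
      ring
    rw [h1, enorm_mul, mul_pow]
    have h2 := enorm_intervalIntegral_sq_le ((hVm' s).sub
      (aestronglyMeasurable_const (b := V s))) ht.le
    have h3 : ‖(t : ℂ)⁻¹‖ₑ = (ENNReal.ofReal t)⁻¹ := by
      rw [enorm_inv (by exact_mod_cast ht.ne'), ← ofReal_norm, Complex.norm_real,
        Real.norm_of_nonneg ht.le]
    rw [h3]
    have h4 : ENNReal.ofReal t ≠ 0 := by simpa using ht
    calc _ ≤ (ENNReal.ofReal t)⁻¹ ^ 2 * (ENNReal.ofReal (t - 0) * _) := by gcongr; exact h2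
      _ = _ := by
        rw [sub_zero, ← mul_assoc, sq, mul_assoc _ _ (ENNReal.ofReal t),
          ENNReal.inv_mul_cancel h4 (by simp), mul_one]
        rfl
  have hω := tendsto_lintegral_translate_sub hV
  rw [ENNReal.tendsto_nhds_zero] at hω ⊢
  intro ε hε
  obtain ⟨δ, hδ, hball⟩ := Metric.eventually_nhds_iff.1 (hω ε hε)
  filter_upwards [Ioo_mem_nhdsGT hδ] with t ht
  have h4 : ENNReal.ofReal t ≠ 0 := by simpa using ht.1
  calc _ ≤ _ := key t ht.1
    _ ≤ (ENNReal.ofReal t)⁻¹ * ∫⁻ r in Ioc 0 t, ε := by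
      refine mul_le_mul_right (setLIntegral_mono' measurableSet_Ioc fun r hr => hball ?_) _
      rw [Real.dist_eq, sub_zero, abs_of_pos hr.1]
      exact hr.2.trans_lt ht.2
    _ = ε := by
      rw [setLIntegral_const, Real.volume_Ioc, sub_zero, mul_comm ε, ← mul_assoc,
        ENNReal.inv_mul_cancel h4 (by simp), one_mul]

theorem tendsto_integral_norm_sq_iff_s16 {l : Filter ℝ} {h : ℝ → ℝ → ℂ}
    (hh : ∀ t, MemLp (h t) 2 volume) :
    Tendsto (fun t => ∫ s, ‖h t s‖ ^ 2) l (𝓝 0) ↔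
      Tendsto (fun t => ∫⁻ s, ‖h t s‖ₑ ^ 2) l (𝓝 0) := by
  have h1 : ∀ t, ∫⁻ s, ‖h t s‖ₑ ^ 2 ≠ ⊤ := fun t => by
    rw [← eLpNorm_two_sq_s16]
    exact ENNReal.pow_ne_top (hh t).eLpNorm_ne_top
  rw [← ENNReal.tendsto_toReal_iff h1 (by simp)]
  simp only [integral_norm_sq_eq_toReal (hh _).1, ENNReal.toReal_zero]

theorem exists_orderIso_hasDerivAt {th : ℝ → ℝ} (hc : ContinuousOn th (Ici 0))
    (hneg : ∀ ξ ∈ Ici (0 : ℝ), th ξ < 0)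
    {p : ℝ → ℝ} (hp : ∀ ξ, p ξ = ∫ ζ in (0 : ℝ)..ξ, (th ζ)⁻¹) {pinv : ℝ → ℝ}
    (hmem : ∀ s ∈ Iic (0 : ℝ), pinv s ∈ Ici (0 : ℝ))
    (hright : ∀ s ∈ Iic (0 : ℝ), p (pinv s) = s) :
    ∃ q : ℝ ≃o ℝ, (∀ ξ, 0 ≤ ξ → q.symm ξ = -p ξ) ∧ q 0 = 0 ∧
      (∀ s, HasDerivAt q (-th (max (q s) 0)) s) ∧ Differentiable ℝ q.symm := by
  set k : ℝ → ℝ := fun ξ => -(th (max ξ 0))⁻¹ with hk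
  have hm : ∀ ξ, th (max ξ 0) < 0 := fun ξ => hneg _ (le_max_right ξ 0)
  have hkc : Continuous k := by
    have : Continuous fun ξ : ℝ => th (max ξ 0) :=
      hc.comp_continuous (by fun_prop) fun ξ => le_max_right ξ 0
    exact (this.inv₀ fun ξ => (hm ξ).ne).neg
  have hkpos : ∀ ξ, 0 < k ξ := fun ξ => neg_pos.2 (inv_lt_zero.2 (hm ξ))
  set φ : ℝ → ℝ := fun ξ => ∫ ζ in (0 : ℝ)..ξ, k ζ with hφ
  have hd : ∀ ξ, HasDerivAt φ (k ξ) ξ := fun ξ =>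
    intervalIntegral.integral_hasDerivAt_right (hkc.intervalIntegrable _ _)
      hkc.stronglyMeasurable.stronglyMeasurableAtFilter hkc.continuousAt
  have hφp : ∀ ξ, 0 ≤ ξ → φ ξ = -p ξ := by
    intro ξ hξ
    rw [hp, ← intervalIntegral.integral_neg]
    refine intervalIntegral.integral_congr fun ζ hζ => ?_
    rw [uIcc_of_le hξ] at hζ
    simp [hk, max_eq_left hζ.1]
  have hφm : ∀ ξ, ξ ≤ 0 → φ ξ = -ξ / th 0 := by
    intro ξ hξ
    have : φ ξ = ∫ ζ in (0 : ℝ)..ξ, -(th 0)⁻¹ := by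
      refine intervalIntegral.integral_congr fun ζ hζ => ?_
      rw [uIcc_of_ge hξ] at hζ
      simp [hk, max_eq_right hζ.2]
    rw [this, intervalIntegral.integral_const, smul_eq_mul]
    ring
  have hmono : StrictMono φ := strictMono_of_deriv_pos fun ξ => by
    rw [(hd ξ).deriv]; exact hkpos ξ
  have h0 := hneg 0 self_mem_Ici
  have hsurj : Function.Surjective φ := by
    intro s
    rcases le_or_gt 0 s with hs | hs
    · have hs' : -s ∈ Iic (0 : ℝ) := by simpa using hs
      exact ⟨pinv (-s), by rw [hφp _ (hmem _ hs'), hright _ hs', neg_neg]⟩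
    · refine ⟨-(s * th 0), ?_⟩
      rw [hφm _ (by nlinarith), neg_neg, mul_div_cancel_right₀ _ h0.ne]
  set e : ℝ ≃o ℝ := hmono.orderIsoOfSurjective φ hsurj with he
  have hes : ∀ s, φ (e.symm s) = s := fun s => e.apply_symm_apply s
  refine ⟨e.symm, fun ξ hξ => hφp ξ hξ, ?_, fun s => ?_, fun ξ => (hd ξ).differentiableAt⟩
  · apply hmono.injective
    rw [hes]
    simp [hφ]
  · have := HasDerivAt.of_local_left_inverse (e.symm.continuous.continuousAt) (hd (e.symm s))
      (hkpos _).ne' (Eventually.of_forall hes)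
    simpa [hk, inv_neg] using this

theorem quasiMeasurePreserving_of_differentiable_symm (q : ℝ ≃o ℝ)
    (hq : Differentiable ℝ q.symm) : Measure.QuasiMeasurePreserving q volume volume := by
  refine ⟨q.continuous.measurable, Measure.AbsolutelyContinuous.mk fun N hN hN0 => ?_⟩
  rw [Measure.map_apply q.continuous.measurable hN]
  have : q ⁻¹' N = q.symm '' N := (q.symm.toEquiv.image_eq_preimage_symm N).symm
  rw [this]
  exact addHaar_image_eq_zero_of_differentiableOn_of_addHaar_eq_zero volume hq.differentiableOn hN0

theorem quasiMeasurePreserving_restrict_Ici (q : ℝ ≃o ℝ)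
    (hq : Differentiable ℝ q.symm) (hq0 : q 0 = 0) :
    Measure.QuasiMeasurePreserving q (volume.restrict (Ici 0)) (volume.restrict (Ici 0)) := by
  refine (quasiMeasurePreserving_of_differentiable_symm q hq).restrict fun s hs => ?_
  rw [mem_Ici] at hs ⊢
  simpa only [hq0] using q.monotone hs

/-- The change of variables `ξ = q s`, `u = θ x`, extended by zero to the negative half-line. -/
noncomputable def transplant (th q : ℝ → ℝ) (x : ℝ → ℂ) : ℝ → ℂ :=
  (Ici (0 : ℝ)).indicator fun s => (th (q s) : ℂ) * x (q s)

theorem transplant_of_nonneg (th q : ℝ → ℝ) (x : ℝ → ℂ) {s : ℝ} (hs : 0 ≤ s) :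
    transplant th q x s = (th (q s) : ℂ) * x (q s) :=
  indicator_of_mem (mem_Ici.2 hs) _

theorem transplant_of_neg (th q : ℝ → ℝ) (x : ℝ → ℂ) {s : ℝ} (hs : s < 0) :
    transplant th q x s = 0 :=
  indicator_of_notMem (by simpa using hs) _

section ChangeOfVariables

variable {th : ℝ → ℝ} {q : ℝ ≃o ℝ}

theorem aestronglyMeasurable_transplant (hc : ContinuousOn th (Ici 0)) (hq0 : q 0 = 0)
    (hq : Differentiable ℝ q.symm) {x : ℝ → ℂ}
    (hx : AEStronglyMeasurable x (volume.restrict (Ici 0))) :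
    AEStronglyMeasurable (transplant th q x) volume := by
  refine (aestronglyMeasurable_indicator_iff measurableSet_Ici).2 ?_
  have h1 : AEStronglyMeasurable (fun ξ => (th ξ : ℂ)) (volume.restrict (Ici 0)) :=
    (Complex.continuous_ofReal.comp_continuousOn hc).aestronglyMeasurable measurableSet_Ici
  exact (h1.mul hx).comp_quasiMeasurePreserving (quasiMeasurePreserving_restrict_Ici q hq hq0)

theorem aestronglyMeasurable_of_transplant (hc : ContinuousOn th (Ici 0))
    (hneg : ∀ ξ ∈ Ici (0 : ℝ), th ξ < 0) (hq0 : q 0 = 0)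
    (hq : Differentiable ℝ q) {x : ℝ → ℂ}
    (hx : AEStronglyMeasurable (transplant th q x) volume) :
    AEStronglyMeasurable x (volume.restrict (Ici 0)) := by
  have hs0 : q.symm 0 = 0 := by rw [q.symm_apply_eq, hq0]
  have h1 : AEStronglyMeasurable (fun ξ => (th ξ : ℂ)) (volume.restrict (Ici 0)) :=
    (Complex.continuous_ofReal.comp_continuousOn hc).aestronglyMeasurable measurableSet_Ici
  have h2 := hx.restrict (s := Ici 0) |>.comp_quasiMeasurePreserving
    (quasiMeasurePreserving_restrict_Ici q.symm hq hs0)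
  refine (h1.inv₀.mul h2).congr ?_
  filter_upwards [ae_restrict_mem measurableSet_Ici] with ξ hξ
  have h3 : 0 ≤ q.symm ξ := by rw [← hs0]; exact q.symm.monotone hξ
  have h4 : (th ξ : ℂ) ≠ 0 := by exact_mod_cast (hneg ξ hξ).ne
  simp [transplant_of_nonneg _ _ _ h3, h4]

theorem orderIso_nonneg (hq0 : q 0 = 0) {s : ℝ} (hs : 0 ≤ s) : 0 ≤ q s := by
  simpa only [hq0] using q.monotone hs

theorem hasDerivWithinAt_orderIso (hq0 : q 0 = 0)
    (hqd : ∀ s, HasDerivAt q (-th (max (q s) 0)) s) {S : Set ℝ} :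
    ∀ s ∈ Ici (0 : ℝ), HasDerivWithinAt q (-th (q s)) S s := by
  intro s hs
  have := hqd s
  rw [max_eq_left (orderIso_nonneg hq0 hs)] at this
  exact this.hasDerivWithinAt

theorem orderIso_image_Ici (hq0 : q 0 = 0) : q '' Ici 0 = Ici 0 := by
  rw [q.image_Ici, hq0]

theorem weight_mul_norm_sq_eq (x : ℝ → ℂ) {s : ℝ} (hs : s ∈ Ici 0) :
    |(-th (q s))| • (|th (q s)| * ‖x (q s)‖ ^ 2) = ‖transplant th q x s‖ ^ 2 := by
  rw [transplant_of_nonneg _ _ _ hs, norm_mul, Complex.norm_real, Real.norm_eq_abs, abs_neg,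
    smul_eq_mul]
  ring

theorem integrableOn_weight_iff (hq0 : q 0 = 0)
    (hqd : ∀ s, HasDerivAt q (-th (max (q s) 0)) s) (x : ℝ → ℂ) :
    IntegrableOn (fun ξ => |th ξ| * ‖x ξ‖ ^ 2) (Ici 0) ↔
      Integrable fun s => ‖transplant th q x s‖ ^ 2 := by
  have h1 := integrableOn_image_iff_integrableOn_abs_deriv_smul measurableSet_Ici
    (hasDerivWithinAt_orderIso hq0 hqd) q.injective.injOn (fun ξ => |th ξ| * ‖x ξ‖ ^ 2)
  rw [orderIso_image_Ici hq0] at h1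
  rw [h1, ← integrable_indicator_iff measurableSet_Ici]
  refine integrable_congr (ae_of_all _ fun s => ?_)
  by_cases hs : s ∈ Ici (0 : ℝ)
  · rw [indicator_of_mem hs, weight_mul_norm_sq_eq x hs]
  · simp only [indicator_of_notMem hs, transplant_of_neg _ _ _ (not_le.1 hs)]
    simp

theorem setIntegral_weight_eq (hq0 : q 0 = 0)
    (hqd : ∀ s, HasDerivAt q (-th (max (q s) 0)) s) (x : ℝ → ℂ) :
    ∫ ξ in Ici (0 : ℝ), |th ξ| * ‖x ξ‖ ^ 2 = ∫ s, ‖transplant th q x s‖ ^ 2 := by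
  have h1 := integral_image_eq_integral_abs_deriv_smul measurableSet_Ici
    (hasDerivWithinAt_orderIso hq0 hqd) q.injective.injOn (fun ξ => |th ξ| * ‖x ξ‖ ^ 2)
  rw [orderIso_image_Ici hq0] at h1
  rw [h1, ← integral_indicator measurableSet_Ici]
  refine integral_congr_ae (ae_of_all _ fun s => ?_)
  by_cases hs : s ∈ Ici (0 : ℝ)
  · simp only [indicator_of_mem hs, weight_mul_norm_sq_eq x hs]
  · simp only [indicator_of_notMem hs, transplant_of_neg _ _ _ (not_le.1 hs)]
    simp

theorem memLp_transplant (hc : ContinuousOn th (Ici 0)) (hq0 : q 0 = 0)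
    (hqd : ∀ s, HasDerivAt q (-th (max (q s) 0)) s) (hq : Differentiable ℝ q.symm) {x : ℝ → ℂ}
    (hx : AEStronglyMeasurable x (volume.restrict (Ici 0)))
    (hxi : IntegrableOn (fun ξ => |th ξ| * ‖x ξ‖ ^ 2) (Ici 0)) :
    MemLp (transplant th q x) 2 volume :=
  (memLp_two_iff_integrable_sq_norm (aestronglyMeasurable_transplant hc hq0 hq hx)).2
    ((integrableOn_weight_iff hq0 hqd x).1 hxi)

theorem intervalIntegral_transplant (hneg : ∀ ξ ∈ Ici (0 : ℝ), th ξ < 0) (hq0 : q 0 = 0)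
    (hqd : ∀ s, HasDerivAt q (-th (max (q s) 0)) s) (g : ℝ → ℂ) {s : ℝ} (hs : 0 ≤ s) :
    ∫ ζ in (0 : ℝ)..q s, g ζ = -∫ r in (0 : ℝ)..s, transplant th q g r := by
  have h1 := integral_image_eq_integral_abs_deriv_smul (s := Icc 0 s) measurableSet_Icc
    (fun r hr => hasDerivWithinAt_orderIso hq0 hqd r hr.1) q.injective.injOn g
  rw [q.image_Icc, hq0] at h1
  rw [intervalIntegral.integral_of_le (orderIso_nonneg hq0 hs), intervalIntegral.integral_of_le hs,
    ← integral_Icc_eq_integral_Ioc, ← integral_Icc_eq_integral_Ioc, h1, ← integral_neg]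
  refine setIntegral_congr_fun measurableSet_Icc fun r hr => ?_
  have h2 := hneg (q r) (orderIso_nonneg hq0 hr.1)
  simp only [transplant_of_nonneg _ _ _ hr.1]
  rw [abs_of_pos (neg_pos.2 h2)]
  simp

theorem intervalIntegrable_of_memLp_transplant (hneg : ∀ ξ ∈ Ici (0 : ℝ), th ξ < 0)
    (hq0 : q 0 = 0) (hqd : ∀ s, HasDerivAt q (-th (max (q s) 0)) s) {g : ℝ → ℂ}
    (hg : MemLp (transplant th q g) 2 volume) {b : ℝ} (hb : 0 ≤ b) :
    IntervalIntegrable g volume 0 b := by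
  obtain ⟨s, rfl⟩ := q.surjective b
  have hs : 0 ≤ s := by rwa [← q.le_iff_le, hq0]
  have h1 := integrableOn_image_iff_integrableOn_abs_deriv_smul (s := Icc 0 s) measurableSet_Icc
    (fun r hr => hasDerivWithinAt_orderIso hq0 hqd r hr.1) q.injective.injOn g
  rw [q.image_Icc, hq0] at h1
  rw [intervalIntegrable_iff_integrableOn_Icc_of_le hb, h1]
  refine (((hg.locallyIntegrable (by norm_num)).integrableOn_isCompact
    (isCompact_Icc (a := 0) (b := s))).neg).congr_fun (fun r hr => ?_) measurableSet_Icc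
  have h2 := hneg (q r) (orderIso_nonneg hq0 hr.1)
  simp only [Pi.neg_apply, transplant_of_nonneg _ _ _ hr.1]
  rw [abs_of_pos (neg_pos.2 h2)]
  simp

theorem ae_restrict_Ici_iff_orderIso (hq0 : q 0 = 0) (hq : Differentiable ℝ q)
    (hq' : Differentiable ℝ q.symm) {A : ℝ → Prop} :
    (∀ᵐ ξ ∂volume.restrict (Ici (0 : ℝ)), A ξ) ↔ ∀ᵐ s : ℝ, 0 ≤ s → A (q s) := by
  have h1 : (∀ᵐ s : ℝ, 0 ≤ s → A (q s)) ↔ ∀ᵐ s ∂volume.restrict (Ici (0 : ℝ)), A (q s) :=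
    (ae_restrict_iff' measurableSet_Ici).symm
  rw [h1]
  have hs0 : q.symm 0 = 0 := by rw [q.symm_apply_eq, hq0]
  refine ⟨(quasiMeasurePreserving_restrict_Ici q hq' hq0).ae, fun h => ?_⟩
  simpa using (quasiMeasurePreserving_restrict_Ici q.symm hq hs0).ae h

end ChangeOfVariables

/-- The weighted right-shift semigroup on `L²_{|θ|}(0,∞)` (with truncation at the
boundary) is a strongly continuous contraction semigroup whose generator is
`A_θ x = (θ·x)'` on
`D(A_θ) = {x : θ·x ∈ AC_loc[0,∞), (θ·x)' ∈ L²_{|θ|}(0,∞), (θ·x)(0) = 0}`. -/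
theorem stmt_16 (th : ℝ → ℝ)
    (hc : ContinuousOn th (Set.Ici 0))
    (hneg : ∀ ξ ∈ Set.Ici (0:ℝ), th ξ < 0)
    (hni : ¬ IntegrableOn (fun ζ => (th ζ)⁻¹) (Set.Ioi 0))
    -- `p_θ(ξ) = ∫₀^ξ θ(ζ)⁻¹ dζ`
    (p : ℝ → ℝ) (hp : ∀ ξ, p ξ = ∫ ζ in (0:ℝ)..ξ, (th ζ)⁻¹)
    -- `p_θ` is a strictly decreasing bijection of `[0,∞)` onto `(−∞,0]`
    -- with inverse `pinv : (−∞,0] → [0,∞)`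
    (pinv : ℝ → ℝ)
    (hpinv_mem : ∀ s ∈ Set.Iic (0:ℝ), pinv s ∈ Set.Ici (0:ℝ))
    (hpinv_right : ∀ s ∈ Set.Iic (0:ℝ), p (pinv s) = s)
    (hpinv_left : ∀ ξ ∈ Set.Ici (0:ℝ), pinv (p ξ) = ξ)
    -- `μ_θ(ξ,t) = p_θ⁻¹(p_θ(ξ)+t) − ξ` for `p_θ(ξ)+t ≤ 0`
    (mu : ℝ → ℝ → ℝ) (hmu : ∀ ξ t, p ξ + t ≤ 0 → mu ξ t = pinv (p ξ + t) - ξ)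
    -- `(T_θ(t)x)(ξ) = (θ(ξ+μ_θ(ξ,t))/θ(ξ)) · x(ξ+μ_θ(ξ,t))` if `p_θ(ξ)+t ≤ 0`, else `0`
    (T : ℝ → (ℝ → ℂ) → ℝ → ℂ)
    (hT : ∀ t x ξ, T t x ξ =
      if p ξ + t ≤ 0 then ((th (ξ + mu ξ t) / th ξ : ℝ) : ℂ) * x (ξ + mu ξ t) else 0) :
    -- (a) each `T_θ(t)`, `t ≥ 0`, is a well-defined linear contraction of `L²_{|θ|}(0,∞)`
    (∀ x y : ℝ → ℂ, ∀ c : ℂ, ∀ t ξ : ℝ,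
      T t (fun ζ => x ζ + c • y ζ) ξ = T t x ξ + c • T t y ξ) ∧
    (∀ t : ℝ, 0 ≤ t → ∀ x : ℝ → ℂ,
      AEStronglyMeasurable x (volume.restrict (Set.Ici 0)) →
      IntegrableOn (fun ξ => |th ξ| * ‖x ξ‖ ^ 2) (Set.Ici 0) →
      AEStronglyMeasurable (T t x) (volume.restrict (Set.Ici 0)) ∧
      IntegrableOn (fun ξ => |th ξ| * ‖T t x ξ‖ ^ 2) (Set.Ici 0) ∧
      (∫ ξ in Set.Ici (0:ℝ), |th ξ| * ‖T t x ξ‖ ^ 2) ≤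
        ∫ ξ in Set.Ici (0:ℝ), |th ξ| * ‖x ξ‖ ^ 2) ∧
    -- (b) semigroup property
    (∀ x : ℝ → ℂ, ∀ ξ ∈ Set.Ici (0:ℝ), T 0 x ξ = x ξ) ∧
    (∀ s t : ℝ, 0 ≤ s → 0 ≤ t → ∀ x : ℝ → ℂ, ∀ ξ ∈ Set.Ici (0:ℝ),
      T t (T s x) ξ = T (t + s) x ξ) ∧
    -- (c) strong continuity
    (∀ x : ℝ → ℂ,
      AEStronglyMeasurable x (volume.restrict (Set.Ici 0)) →
      IntegrableOn (fun ξ => |th ξ| * ‖x ξ‖ ^ 2) (Set.Ici 0) →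
      ∀ t₀ ∈ Set.Ici (0:ℝ),
        Tendsto (fun t => ∫ ξ in Set.Ici (0:ℝ), |th ξ| * ‖T t x ξ - T t₀ x ξ‖ ^ 2)
          (𝓝[Set.Ici 0] t₀) (𝓝 0)) ∧
    -- (d) characterization of the generator
    (∀ x : ℝ → ℂ,
      AEStronglyMeasurable x (volume.restrict (Set.Ici 0)) →
      IntegrableOn (fun ξ => |th ξ| * ‖x ξ‖ ^ 2) (Set.Ici 0) →
      ∀ g : ℝ → ℂ,
        AEStronglyMeasurable g (volume.restrict (Set.Ici 0)) →
        IntegrableOn (fun ξ => |th ξ| * ‖g ξ‖ ^ 2) (Set.Ici 0) →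
        (Tendsto (fun t : ℝ =>
              ∫ ξ in Set.Ici (0:ℝ), |th ξ| * ‖(T t x ξ - x ξ) / (t : ℂ) - g ξ‖ ^ 2)
            (𝓝[>] (0:ℝ)) (𝓝 0)
          ↔ ∃ y : ℝ → ℂ,
              (∀ᵐ ξ ∂volume.restrict (Set.Ici 0), y ξ = (th ξ : ℂ) * x ξ) ∧
              y 0 = 0 ∧
              ∀ a ∈ Set.Ici (0:ℝ), ∀ b ∈ Set.Ici (0:ℝ),
                y b - y a = ∫ ζ in a..b, g ζ)) := by
  obtain ⟨q, hqp, hq0, hqd, hqs⟩ := exists_orderIso_hasDerivAt hc hneg hp hpinv_mem hpinv_right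
  have hq : Differentiable ℝ q := fun s => (hqd s).differentiableAt
  have hpq : ∀ s, 0 ≤ s → p (q s) = -s := fun s hs => by
    rw [← neg_neg (p (q s)), ← hqp _ (orderIso_nonneg hq0 hs), q.symm_apply_apply]
  have hqpinv : ∀ s, 0 ≤ s → pinv (-s) = q s := fun s hs => by
    rw [← hpq s hs, hpinv_left _ (orderIso_nonneg hq0 hs)]
  have hp0 : ∀ ξ, 0 ≤ ξ → p ξ ≤ 0 := fun ξ hξ => by
    obtain ⟨s, rfl⟩ := q.surjective ξ
    have hs : 0 ≤ s := by rwa [← q.le_iff_le, hq0]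
    rw [hpq s hs]
    exact neg_nonpos.2 hs
  have hT' : ∀ t x ξ, T t x ξ =
      if p ξ + t ≤ 0 then ((th (pinv (p ξ + t)) / th ξ : ℝ) : ℂ) * x (pinv (p ξ + t)) else 0 := by
    intro t x ξ
    rw [hT]
    split_ifs with h
    · rw [hmu _ _ h, add_sub_cancel]
    · rfl
  have hth : ∀ s, 0 ≤ s → (th (q s) : ℂ) ≠ 0 := fun s hs => by
    exact_mod_cast (hneg _ (orderIso_nonneg hq0 hs)).ne
  have hshift : ∀ t, 0 ≤ t → ∀ x s,
      transplant th q (T t x) s = transplant th q x (s - t) := by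
    intro t ht x s
    rcases lt_or_ge s 0 with hs | hs
    · rw [transplant_of_neg _ _ _ hs, transplant_of_neg _ _ _ (by linarith)]
    · rw [transplant_of_nonneg _ _ _ hs, hT', hpq s hs]
      split_ifs with h
      · have hst : 0 ≤ s - t := by linarith
        have h1 : pinv (-s + t) = q (s - t) := by rw [← hqpinv _ hst, neg_sub, neg_add_eq_sub]
        have h2 := hth s hs
        rw [transplant_of_nonneg _ _ _ hst, h1, Complex.ofReal_div]
        field_simp
      · rw [transplant_of_neg _ _ _ (by linarith), mul_zero]
  have hmp : ∀ t : ℝ, MeasurePreserving (fun s : ℝ => s - t) volume volume :=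
    measurePreserving_sub_right volume
  have hL2 : ∀ x : ℝ → ℂ, AEStronglyMeasurable x (volume.restrict (Ici 0)) →
      IntegrableOn (fun ξ => |th ξ| * ‖x ξ‖ ^ 2) (Ici 0) → MemLp (transplant th q x) 2 volume :=
    fun x hx hxi => memLp_transplant hc hq0 hqd hqs hx hxi
  have hL2t : ∀ (x : ℝ → ℂ) (t : ℝ), MemLp (transplant th q x) 2 volume →
      MemLp (fun s => transplant th q x (s - t)) 2 volume :=
    fun x t hx => hx.comp_measurePreserving (hmp t)
  refine ⟨?_, ?_, ?_, ?_, ?_, ?_⟩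
  · intro x y c t ξ
    simp only [hT', smul_eq_mul]
    split_ifs
    · ring
    · simp
  · intro t ht x hx hxi
    have hU := hL2t x t (hL2 x hx hxi)
    have hTU : transplant th q (T t x) = fun s => transplant th q x (s - t) :=
      funext (hshift t ht x)
    refine ⟨aestronglyMeasurable_of_transplant hc hneg hq0 hq (hTU ▸ hU.1),
      (integrableOn_weight_iff hq0 hqd _).2 ?_, ?_⟩
    · rw [hTU]
      exact (memLp_two_iff_integrable_sq_norm hU.1).1 hU
    · rw [setIntegral_weight_eq hq0 hqd, setIntegral_weight_eq hq0 hqd, hTU]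
      exact (integral_sub_right_eq_self (fun s => ‖transplant th q x s‖ ^ 2) t).le
  · intro x ξ hξ
    have h1 : (th ξ : ℂ) ≠ 0 := by exact_mod_cast (hneg ξ hξ).ne
    rw [hT', add_zero, if_pos (hp0 ξ hξ), hpinv_left ξ hξ, Complex.ofReal_div, div_self h1, one_mul]
  · intro s t hs ht x ξ hξ
    obtain ⟨r, rfl⟩ := q.surjective ξ
    have hr : 0 ≤ r := by rwa [mem_Ici, ← hq0, q.le_iff_le] at hξ
    have h1 := hshift t ht (T s x) r
    rw [hshift s hs, sub_sub, ← hshift (t + s) (add_nonneg ht hs),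
      transplant_of_nonneg _ _ _ hr, transplant_of_nonneg _ _ _ hr] at h1
    exact mul_left_cancel₀ (hth r hr) h1
  · intro x hx hxi t₀ ht₀
    have hU := hL2 x hx hxi
    have h1 : Tendsto (fun t : ℝ => ∫ s, ‖transplant th q x (s - t) - transplant th q x s‖ ^ 2)
        (𝓝 0) (𝓝 0) :=
      (tendsto_integral_norm_sq_iff_s16 fun t => (hL2t x t hU).sub hU).2
        (tendsto_lintegral_translate_sub hU)
    have h2 : Tendsto (fun t : ℝ => t - t₀) (𝓝[Ici 0] t₀) (𝓝 0) := by
      have : ContinuousAt (fun t : ℝ => t - t₀) t₀ := by fun_prop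
      simpa only [ContinuousAt, sub_self] using this.tendsto.mono_left nhdsWithin_le_nhds
    refine (h1.comp h2).congr' ?_
    filter_upwards [self_mem_nhdsWithin] with t ht
    rw [setIntegral_weight_eq hq0 hqd (fun ξ => T t x ξ - T t₀ x ξ), Function.comp_apply,
      ← integral_sub_right_eq_self _ t₀]
    refine integral_congr_ae (ae_of_all _ fun s => ?_)
    have h3 : transplant th q (fun ξ => T t x ξ - T t₀ x ξ) s =
        transplant th q x (s - t) - transplant th q x (s - t₀) := by
      rw [← hshift t ht, ← hshift t₀ ht₀]
      simp only [transplant, indicator_apply]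
      split_ifs
      · ring
      · simp
    simp only [h3, sub_sub, add_sub_cancel]
  · intro x hx hxi g hg hgi
    have hU := hL2 x hx hxi
    have hV := hL2 g hg hgi
    have hdiff : ∀ t : ℝ, MemLp (fun s => (transplant th q x (s - t) - transplant th q x s) /
        (t : ℂ) - transplant th q g s) 2 volume := fun t => by
      simp only [div_eq_mul_inv]
      exact (((hL2t x t hU).sub hU).mul_const _).sub hV
    have h1 : (fun t : ℝ => ∫ ξ in Ici (0 : ℝ), |th ξ| * ‖(T t x ξ - x ξ) / (t : ℂ) - g ξ‖ ^ 2)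
        =ᶠ[𝓝[>] (0 : ℝ)] fun t : ℝ => ∫ s, ‖(transplant th q x (s - t) - transplant th q x s) /
          (t : ℂ) - transplant th q g s‖ ^ 2 := by
      filter_upwards [self_mem_nhdsWithin] with t ht
      rw [setIntegral_weight_eq hq0 hqd (fun ξ => (T t x ξ - x ξ) / (t : ℂ) - g ξ)]
      refine integral_congr_ae (ae_of_all _ fun s => ?_)
      have h3 : transplant th q (fun ξ => (T t x ξ - x ξ) / (t : ℂ) - g ξ) s =
          (transplant th q x (s - t) - transplant th q x s) / (t : ℂ) - transplant th q g s := by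
        rw [← hshift t (le_of_lt ht)]
        simp only [transplant, indicator_apply]
        split_ifs
        · ring
        · simp
      simp only [h3]
    have hU0 : ∀ s < 0, transplant th q x s = 0 := fun s hs => transplant_of_neg _ _ _ hs
    have hV0 : ∀ s < 0, transplant th q g s = 0 := fun s hs => transplant_of_neg _ _ _ hs
    have h2 : (∀ᵐ ξ ∂volume.restrict (Ici (0 : ℝ)), (th ξ : ℂ) * x ξ = ∫ ζ in (0 : ℝ)..ξ, g ζ) ↔
        ∀ᵐ s : ℝ, 0 ≤ s → transplant th q x s = -∫ r in (0 : ℝ)..s, transplant th q g r := by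
      rw [ae_restrict_Ici_iff_orderIso hq0 hq hqs]
      refine eventually_congr (ae_of_all _ fun s => forall_congr' fun hs => ?_)
      rw [transplant_of_nonneg _ _ _ hs, intervalIntegral_transplant hneg hq0 hqd g hs]
    rw [tendsto_congr' h1, tendsto_integral_norm_sq_iff_s16 hdiff]
    constructor
    · intro h
      have hgi' : ∀ b, 0 ≤ b → IntervalIntegrable g volume 0 b := fun b hb =>
        intervalIntegrable_of_memLp_transplant hneg hq0 hqd hV hb
      refine ⟨fun ξ => ∫ ζ in (0 : ℝ)..ξ, g ζ, ?_, intervalIntegral.integral_same, ?_⟩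
      · filter_upwards [h2.2 (ae_eq_neg_integral_of_tendsto_translate hU hV hU0 h)] with ξ hξ
        exact hξ.symm
      · intro a ha b hb
        exact intervalIntegral.integral_interval_sub_left (hgi' b hb) (hgi' a ha)
    · rintro ⟨y, hy, hy0, hyg⟩
      refine tendsto_translate_of_ae_eq_neg_integral hV hU0 hV0 (h2.1 ?_)
      filter_upwards [hy, ae_restrict_mem measurableSet_Ici] with ξ hξ hξ0
      rw [← hξ, ← hyg 0 self_mem_Ici ξ hξ0, hy0, sub_zero]
end

section
/- Let n₊, n₋ ≥ 1 and n = n₊ + n₋. Let λ₁,…,λ_{n₊} : [0,∞) → (0,∞) and θ₁,…,θ_{n₋} : [0,∞) → (−∞,0) be continuous and bounded (so in particular 1/λ_k and 1/θ_j are not Lebesgue-integrable on (0,∞)). Set Λ = diag(λ₁,…,λ_{n₊}), Θ = diag(θ₁,…,θ_{n₋}), Δ = diag(Λ,Θ), and |Δ| = diag(λ₁,…,λ_{n₊},|θ₁|,…,|θ_{n₋}|). Let K ∈ ℂ^{n₋×n₋} and Q ∈ ℂ^{n₋×n₊} be matrices such that the block matrix [K Q] ∈ ℂ^{n₋×n}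 has rank n₋. Define the operator A_Δ x = (Δ·x)′ on the domain D(A_Δ) consisting of those x ∈ L²_{|Δ|}(0,∞) such that Δ·x has a locally absolutely continuous representative y : [0,∞) → ℂⁿ whose a.e. derivative y′ lies in L²_{|Δ|}(0,∞) and such that K·y₋(0) + Q·y₊(0) = 0, where y₊ and y₋ denote the vectors of the first n₊ and last n₋ components of y (so y₊(0) = Λ(0)x₊(0) and y₋(0) = Θ(0)x₋(0)). Then A_Δ generates a strongly continuous semigroup on L²_{|Δ|}(0,∞) if and only if K is invertible. Here 'A_Δ generates a strongly continuous semigroup' means: there exists a family (T(t))_{t≥0} of continuous linear operators on L²_{|Δ|}(0,∞) with T(0) = id, T(t+s) = T(t)∘T(s) for all s,t ≥ 0, t ↦ T(t)x continuous for every x, such that D(A_Δ) = {x ∈ L²_{|Δ|}(0,∞) : lim_{t↓0}(T(t)x − x)/t exists in L²_{|Δ|}(0,∞)} and this limit equals A_Δ x for every x ∈ D(A_Δ). -/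
open MeasureTheory Filter Set Topology

/-- The weighted measure `|d(ξ)| dξ` on `[0,∞)`. -/
noncomputable def wMeasure (d : ℝ → ℝ) : Measure ℝ :=
  (volume.restrict (Set.Ici 0)).withDensity fun ξ => ENNReal.ofReal |d ξ|

/-- The Hilbert space `L²_{|Δ|}(0,∞)` for the diagonal matrix function `Δ = diag(δ k)`,
realized as the `ℓ²`-direct sum of the scalar weighted `L²`-spaces. -/
abbrev HSp {np nm : ℕ} (δ : Fin np ⊕ Fin nm → ℝ → ℝ) : Type :=
  PiLp 2 fun k : Fin np ⊕ Fin nm => Lp ℂ 2 (wMeasure (δ k))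

/-- `x ∈ D(A_Δ)` with data `(y, g)`: `y` is a locally absolutely continuous
representative of `Δ·x` on `[0,∞)` with a.e. derivative `g ∈ L²_{|Δ|}(0,∞)`
(encoded via the fundamental theorem of calculus), and the boundary condition
`K·(Θx)(0) + Q·(Λx)(0) = 0`, i.e. `K·y₋(0) + Q·y₊(0) = 0`, holds. -/
def InDom {np nm : ℕ} (δ : Fin np ⊕ Fin nm → ℝ → ℝ)
    (K : Matrix (Fin nm) (Fin nm) ℂ) (Q : Matrix (Fin nm) (Fin np) ℂ)
    (x : HSp δ) (y g : Fin np ⊕ Fin nm → ℝ → ℂ) : Prop :=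
  (∀ k, ∀ᵐ ξ ∂volume.restrict (Set.Ici 0), y k ξ = (δ k ξ : ℂ) * (x k : ℝ → ℂ) ξ) ∧
  (∀ k, AEStronglyMeasurable (g k) (volume.restrict (Set.Ici 0))) ∧
  (∀ k, IntegrableOn (fun ξ => |δ k ξ| * ‖g k ξ‖ ^ 2) (Set.Ici 0)) ∧
  (∀ k, ∀ a ∈ Set.Ici (0:ℝ), ∀ b ∈ Set.Ici (0:ℝ), y k b - y k a = ∫ ζ in a..b, g k ζ) ∧
  K.mulVec (fun j => y (Sum.inr j) 0) + Q.mulVec (fun j => y (Sum.inl j) 0) = 0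

section TranslationOnLine

/-- The space `L²(ℝ; ℂ)`. -/
local notation "L2R" => Lp ℂ 2 (volume : Measure ℝ)

/-- A weighted composition operator `f ↦ m · (f ∘ φ)` between `L²` spaces is bounded
as soon as `φ` pushes the weight `|m|² dμ` forward to a measure below `ν`. -/
theorem exists_weightedComp {α β : Type*} [MeasurableSpace α] [MeasurableSpace β]
    (μ : Measure α) (ν : Measure β) (φ : α → β) (m : α → ℂ)
    (hφ : Measurable φ) (hm : Measurable m)
    (h : ∀ f : β → ENNReal, Measurable f →
      ∫⁻ a, ‖m a‖ₑ ^ 2 * f (φ a) ∂μ ≤ ∫⁻ b, f b ∂ν) :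
    ∃ A : Lp ℂ 2 ν →L[ℂ] Lp ℂ 2 μ, ∀ f : Lp ℂ 2 ν,
      (A f : α → ℂ) =ᵐ[μ] fun a => m a * (f : β → ℂ) (φ a) := by
  have hae : ∀ p : β → Prop, (∀ᵐ b ∂ν, p b) → ∀ᵐ a ∂μ, m a = 0 ∨ p (φ a) := by
    intro p hp
    obtain ⟨N, hN, hNm, hN0⟩ := exists_measurable_superset_of_null (ae_iff.1 hp)
    have h1 := h (N.indicator 1) (measurable_one.indicator hNm)
    have hmN : Measurable fun a => ‖m a‖ₑ ^ 2 * N.indicator (1 : β → ENNReal) (φ a) :=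
      (hm.enorm.pow_const 2).mul ((measurable_one.indicator hNm).comp hφ)
    rw [lintegral_indicator_one hNm, hN0, nonpos_iff_eq_zero, lintegral_eq_zero_iff hmN] at h1
    filter_upwards [h1] with a ha
    by_contra hcon
    push Not at hcon
    have : φ a ∈ N := hN hcon.2
    simp [this, hcon.1] at ha
  have hmeas : ∀ f : Lp ℂ 2 ν, AEStronglyMeasurable (fun a => m a * (f : β → ℂ) (φ a)) μ :=
    fun f => (hm.mul ((Lp.stronglyMeasurable f).measurable.comp hφ)).aestronglyMeasurable
  have hnorm : ∀ f : Lp ℂ 2 ν,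
      eLpNorm (fun a => m a * (f : β → ℂ) (φ a)) 2 μ ≤ eLpNorm f 2 ν := by
    intro f
    rw [eLpNorm_eq_lintegral_rpow_enorm_toReal (by simp) (by simp),
      eLpNorm_eq_lintegral_rpow_enorm_toReal (by simp) (by simp)]
    refine ENNReal.rpow_le_rpow ?_ (by simp)
    have := h (fun b => ‖(f : β → ℂ) b‖ₑ ^ 2)
      ((Lp.stronglyMeasurable f).measurable.enorm.pow_const 2)
    simpa [enorm_mul, mul_pow] using this
  have hmem : ∀ f : Lp ℂ 2 ν, MemLp (fun a => m a * (f : β → ℂ) (φ a)) 2 μ :=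
    fun f => ⟨hmeas f, (hnorm f).trans_lt (Lp.eLpNorm_lt_top f)⟩
  let A : Lp ℂ 2 ν →ₗ[ℂ] Lp ℂ 2 μ :=
    { toFun := fun f => (hmem f).toLp _
      map_add' := by
        intro f g
        rw [← MemLp.toLp_add, MemLp.toLp_eq_toLp_iff]
        filter_upwards [hae _ (Lp.coeFn_add f g)] with a ha
        rcases ha with ha | ha
        · simp [ha]
        · change m a * (f + g : Lp ℂ 2 ν) (φ a) = m a * f (φ a) + m a * g (φ a)
          rw [ha, Pi.add_apply, mul_add]
      map_smul' := by
        intro c f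
        rw [RingHom.id_apply, ← MemLp.toLp_const_smul, MemLp.toLp_eq_toLp_iff]
        filter_upwards [hae _ (Lp.coeFn_smul c f)] with a ha
        rcases ha with ha | ha
        · simp [ha]
        · simp [ha, mul_left_comm] }
  refine ⟨A.mkContinuous 1 fun f => ?_, fun f => (hmem f).coeFn_toLp⟩
  rw [one_mul]
  change ‖(hmem f).toLp _‖ ≤ ‖f‖
  rw [Lp.norm_toLp, Lp.norm_def]
  exact ENNReal.toReal_mono (Lp.eLpNorm_ne_top f) (hnorm f)

theorem Lp_two_intervalIntegrable (w : L2R) (a b : ℝ) :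
    IntervalIntegrable (w : ℝ → ℂ) volume a b :=
  (((Lp.memLp w).locallyIntegrable (by norm_num)).integrableOn_isCompact
    isCompact_uIcc).intervalIntegrable

/-- The continuous functional `w ↦ ∫₀ᵇ w` on `L²(ℝ)`. -/
noncomputable def primCLM (b : ℝ) : L2R →L[ℂ] ℂ :=
  innerSL ℂ (indicatorConstLp 2 (measurableSet_Ioc (a := (0 : ℝ)) (b := b)) (by simp) 1) -
  innerSL ℂ (indicatorConstLp 2 (measurableSet_Ioc (a := b) (b := (0 : ℝ))) (by simp) 1)

theorem primCLM_apply (b : ℝ) (w : L2R) : primCLM b w = ∫ s in (0 : ℝ)..b, (w : ℝ → ℂ) s := by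
  rw [intervalIntegral, primCLM]
  simp only [sub_apply, innerSL_apply_apply]
  rw [L2.inner_indicatorConstLp_one, L2.inner_indicatorConstLp_one]

theorem primCLM_zero (w : L2R) : primCLM 0 w = 0 := by simp [primCLM_apply]

theorem primCLM_congr {v w : L2R} {b : ℝ}
    (h : ∀ᵐ s, s ∈ Set.uIoc 0 b → (v : ℝ → ℂ) s = (w : ℝ → ℂ) s) :
    primCLM b v = primCLM b w := by
  rw [primCLM_apply, primCLM_apply]
  exact intervalIntegral.integral_congr_ae h

theorem ae_hasDerivAt_primCLM (w : L2R) :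
    ∀ᵐ s, HasDerivAt (fun b => primCLM b w) ((w : ℝ → ℂ) s) s := by
  filter_upwards [LocallyIntegrable.ae_hasDerivAt_integral
    ((Lp.memLp w).locallyIntegrable (by norm_num))] with s hs
  simp_rw [primCLM_apply]
  exact hs 0

theorem continuous_primCLM (w : L2R) : Continuous fun b => primCLM b w := by
  simp_rw [primCLM_apply]
  exact intervalIntegral.continuous_primitive (fun a b => Lp_two_intervalIntegrable w a b) 0

theorem ae_eq_zero_of_primCLM_eq_zero {w : L2R} (h : ∀ b, 0 ≤ b → primCLM b w = 0) :
    ∀ᵐ s, 0 ≤ s → (w : ℝ → ℂ) s = 0 := by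
  filter_upwards [ae_hasDerivAt_primCLM w, Measure.ae_ne volume (0 : ℝ)] with s hs hs0 hs'
  have hpos : 0 < s := lt_of_le_of_ne hs' hs0.symm
  have h0 : HasDerivAt (fun b => primCLM b w) 0 s :=
    (hasDerivAt_const s (0 : ℂ)).congr_of_eventuallyEq
      ((lt_mem_nhds hpos).mono fun b hb => h b hb.le)
  exact hs.unique h0

/-- Translation `w ↦ w (· + t)` on `L²(ℝ)`. -/
noncomputable def transCLM (t : ℝ) : L2R →L[ℂ] L2R :=
  (Lp.compMeasurePreservingₗᵢ ℂ (fun s => s + t)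
    (measurePreserving_add_right volume t)).toContinuousLinearMap

theorem continuous_transCLM (w : L2R) : Continuous fun t => transCLM t w :=
  Continuous.compMeasurePreservingLp (f := fun _ : ℝ => w) (p := 2)
    (g := fun t : ℝ => (⟨fun s => s + t, by fun_prop⟩ : C(ℝ, ℝ)))
    continuous_const
    (ContinuousMap.continuous_of_continuous_uncurry _ (by
      change Continuous fun p : ℝ × ℝ => p.2 + p.1
      fun_prop))
    (fun t => measurePreserving_add_right volume t) (by simp)

theorem primCLM_transCLM (b t : ℝ) (w : L2R) :
    primCLM b (transCLM t w) = primCLM (b + t) w - primCLM t w := by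
  have h : (transCLM t w : ℝ → ℂ) =ᵐ[volume] (w : ℝ → ℂ) ∘ fun s => s + t :=
    Lp.coeFn_compMeasurePreserving w (measurePreserving_add_right volume t)
  rw [primCLM_apply, primCLM_apply, primCLM_apply,
    intervalIntegral.integral_interval_sub_left (Lp_two_intervalIntegrable w _ _)
      (Lp_two_intervalIntegrable w _ _),
    intervalIntegral.integral_congr_ae (g := fun s => (w : ℝ → ℂ) (s + t))
      (h.mono fun s hs _ => hs),
    intervalIntegral.integral_comp_add_right (fun s => (w : ℝ → ℂ) s), zero_add]

/-- Reflection `w ↦ w (-·)` on `L²(ℝ)`. -/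
noncomputable def reflCLM : L2R →L[ℂ] L2R :=
  (Lp.compMeasurePreservingₗᵢ ℂ (fun s : ℝ => -s)
    (Measure.measurePreserving_neg volume)).toContinuousLinearMap

theorem coeFn_reflCLM (w : L2R) : (reflCLM w : ℝ → ℂ) =ᵐ[volume] fun s => (w : ℝ → ℂ) (-s) :=
  Lp.coeFn_compMeasurePreserving w (Measure.measurePreserving_neg volume)

theorem primCLM_reflCLM (b : ℝ) (w : L2R) : primCLM b (reflCLM w) = -primCLM (-b) w := by
  rw [primCLM_apply, primCLM_apply,
    intervalIntegral.integral_congr_ae ((coeFn_reflCLM w).mono fun s hs _ => hs),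
    intervalIntegral.integral_comp_neg (fun s => (w : ℝ → ℂ) s), neg_zero,
    intervalIntegral.integral_symm]

end TranslationOnLine

section TravelTime

/-- For a positive continuous bounded speed `e`, the travel time `ξ ↦ ∫₀^ξ 1/e` is an
order automorphism of `ℝ`, differentiable with differentiable inverse. -/
theorem exists_travelTime (e : ℝ → ℝ) (he : Continuous e) (hpos : ∀ ξ, 0 < e ξ) (M : ℝ)
    (hM : ∀ ξ, e ξ ≤ M) :
    ∃ p : ℝ ≃o ℝ, p 0 = 0 ∧ (∀ ξ, HasDerivAt p (e ξ)⁻¹ ξ) ∧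
      ∀ s, HasDerivAt p.symm (e (p.symm s)) s := by
  have hc : Continuous fun ξ => (e ξ)⁻¹ := he.inv₀ fun ξ => (hpos ξ).ne'
  have hM0 : 0 < M := (hpos 0).trans_le (hM 0)
  set f : ℝ → ℝ := fun ξ => ∫ r in (0 : ℝ)..ξ, (e r)⁻¹ with hf
  have hd : ∀ ξ, HasDerivAt f (e ξ)⁻¹ ξ := fun ξ => hc.integral_hasStrictDerivAt 0 ξ |>.hasDerivAt
  have hmono : StrictMono f := strictMono_of_deriv_pos fun ξ => by
    rw [(hd ξ).deriv]; exact inv_pos.2 (hpos ξ)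
  have hfc : Continuous f := continuous_iff_continuousAt.2 fun ξ => (hd ξ).continuousAt
  have hlow : Monotone fun ξ => f ξ - M⁻¹ * ξ := by
    refine monotone_of_hasDerivAt_nonneg (f' := fun ξ => (e ξ)⁻¹ - M⁻¹ * 1)
      (fun ξ => (hd ξ).sub ((hasDerivAt_id ξ).const_mul M⁻¹)) fun ξ => ?_
    have := inv_anti₀ (hpos ξ) (hM ξ)
    simpa using this
  have hf0 : f 0 = 0 := by simp [hf]
  have htop : Tendsto f atTop atTop := by
    refine tendsto_atTop_mono' _ ?_ (tendsto_id.const_mul_atTop (inv_pos.2 hM0))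
    filter_upwards [eventually_ge_atTop 0] with ξ hξ
    have := hlow hξ
    simp only [hf0, mul_zero, sub_zero] at this
    simpa using this
  have hbot : Tendsto f atBot atBot := by
    refine tendsto_atBot_mono' _ ?_ (tendsto_id.const_mul_atBot (inv_pos.2 hM0))
    filter_upwards [eventually_le_atBot 0] with ξ hξ
    have := hlow hξ
    simp only [hf0, mul_zero, sub_zero] at this
    simpa using this
  let p : ℝ ≃o ℝ := hmono.orderIsoOfSurjective f (hfc.surjective htop hbot)
  refine ⟨p, hf0, hd, fun s => ?_⟩
  have := HasDerivAt.of_local_left_inverse (f := p) (g := p.symm) (a := s)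
    p.symm.toHomeomorph.continuous.continuousAt (hd (p.symm s))
    (inv_ne_zero (hpos _).ne') (Eventually.of_forall fun y => p.apply_symm_apply y)
  rwa [inv_inv] at this

/-- A differentiable order automorphism of `ℝ` has an inverse that pulls null sets back
to null sets. -/
theorem ae_comp_symm_of_differentiable (p : ℝ ≃o ℝ) (hp : Differentiable ℝ p)
    {Q : ℝ → Prop} (h : ∀ᵐ ξ, Q ξ) : ∀ᵐ s, Q (p.symm s) := by
  rw [ae_iff] at h ⊢
  have := addHaar_image_eq_zero_of_differentiableOn_of_addHaar_eq_zero volume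
    (hp.differentiableOn (s := {a | ¬Q a})) h
  convert this
  ext s
  simp only [mem_ofPred_eq, mem_image]
  exact ⟨fun hs => ⟨_, hs, p.apply_symm_apply s⟩, by rintro ⟨a, ha, rfl⟩; simpa using ha⟩

end TravelTime

section Unfolding

local notation "L2R" => Lp ℂ 2 (volume : Measure ℝ)

/-- The scalar part of `InDom`: `y` is a locally absolutely continuous representative of
`d·x` with derivative `g` in the weighted `L²` space. -/
def IsPrimitivePair (d : ℝ → ℝ) (x : Lp ℂ 2 (wMeasure d)) (y g : ℝ → ℂ) : Prop :=
  (∀ᵐ ξ ∂volume.restrict (Set.Ici 0), y ξ = (d ξ : ℂ) * (x : ℝ → ℂ) ξ) ∧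
  AEStronglyMeasurable g (volume.restrict (Set.Ici 0)) ∧
  IntegrableOn (fun ξ => |d ξ| * ‖g ξ‖ ^ 2) (Set.Ici 0) ∧
  ∀ a ∈ Set.Ici (0 : ℝ), ∀ b ∈ Set.Ici (0 : ℝ), y b - y a = ∫ ζ in a..b, g ζ

/-- `J` unfolds the weighted space to functions on `ℝ` supported on the half-line, in travel-time
coordinates, `P` folds back, and the differential expression `(d x)'` becomes `ε` times
differentiation. -/
structure IsUnfolding (d : ℝ → ℝ) (ε : ℝ) (J : Lp ℂ 2 (wMeasure d) →L[ℂ] L2R)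
    (P : L2R →L[ℂ] Lp ℂ 2 (wMeasure d)) : Prop where
  prim_of_nonpos : ∀ x b, b ≤ 0 → primCLM b (J x) = 0
  prim_fold : ∀ w b, 0 ≤ b → primCLM b (J (P w)) = primCLM b w
  separating : ∀ x, (∀ b, 0 ≤ b → primCLM b (J x) = 0) → x = 0
  of_pair : ∀ x y g, IsPrimitivePair d x y g → ∃ L : Lp ℂ 2 (wMeasure d),
    (L : ℝ → ℂ) =ᵐ[volume.restrict (Set.Ici 0)] g ∧
      ∀ᵐ s, 0 ≤ s → (J x : ℝ → ℂ) s = y 0 + ε * primCLM s (J L)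
  to_pair : ∀ (x L : Lp ℂ 2 (wMeasure d)) (c : ℂ),
    (∀ᵐ s, 0 ≤ s → (J x : ℝ → ℂ) s = c + ε * primCLM s (J L)) →
      ∃ y, y 0 = c ∧ IsPrimitivePair d x y L

theorem wMeasure_eq {d e : ℝ → ℝ} (h : ∀ ξ, 0 ≤ ξ → |d ξ| = e ξ) :
    wMeasure d = (volume.restrict (Set.Ici 0)).withDensity fun ξ => ENNReal.ofReal (e ξ) :=
  withDensity_congr_ae <| (ae_restrict_iff' measurableSet_Ici).2 <| ae_of_all _ fun ξ hξ => by
    simp only [h ξ hξ]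

theorem ae_wMeasure_iff {d e : ℝ → ℝ} (h : ∀ ξ, 0 ≤ ξ → |d ξ| = e ξ) (he : Measurable e)
    (hpos : ∀ ξ, 0 < e ξ) {Q : ℝ → Prop} :
    (∀ᵐ ξ ∂wMeasure d, Q ξ) ↔ ∀ᵐ ξ, 0 ≤ ξ → Q ξ := by
  rw [wMeasure_eq h, ae_withDensity_iff he.ennreal_ofReal, ae_restrict_iff' measurableSet_Ici]
  simp [hpos]

theorem memLp_wMeasure_iff {d e : ℝ → ℝ} (h : ∀ ξ, 0 ≤ ξ → |d ξ| = e ξ) (he : Measurable e)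
    (hpos : ∀ ξ, 0 < e ξ) {g : ℝ → ℂ} :
    MemLp g 2 (wMeasure d) ↔ AEStronglyMeasurable g (volume.restrict (Set.Ici 0)) ∧
      IntegrableOn (fun ξ => |d ξ| * ‖g ξ‖ ^ 2) (Set.Ici 0) := by
  have hac : volume.restrict (Set.Ici 0) ≪ wMeasure d := by
    rw [wMeasure_eq h]
    exact withDensity_absolutelyContinuous' he.ennreal_ofReal.aemeasurable
      (ae_of_all _ fun ξ => by simp [hpos])
  have hac' : wMeasure d ≪ volume.restrict (Set.Ici 0) := withDensity_absolutelyContinuous _ _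
  have key : IntegrableOn (fun ξ => |d ξ| * ‖g ξ‖ ^ 2) (Set.Ici 0) ↔
      Integrable (fun ξ => ‖g ξ‖ ^ 2) (wMeasure d) := by
    rw [wMeasure_eq h, integrable_withDensity_iff he.ennreal_ofReal (by simp)]
    refine integrableOn_congr_fun (fun ξ hξ => ?_) measurableSet_Ici
    simp only [h ξ hξ, ENNReal.toReal_ofReal (hpos ξ).le, mul_comm]
  rw [key]
  constructor
  · intro hg
    exact ⟨hg.1.mono_ac hac, (memLp_two_iff_integrable_sq_norm hg.1).1 hg⟩
  · rintro ⟨h1, h2⟩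
    exact (memLp_two_iff_integrable_sq_norm (h1.mono_ac hac')).2 h2

theorem exists_isUnfolding (d : ℝ → ℝ) (ε : ℝ) (hε : ε * ε = 1)
    (hcont : ContinuousOn d (Set.Ici 0)) (hbdd : ∃ M : ℝ, ∀ ξ ∈ Set.Ici (0 : ℝ), |d ξ| ≤ M)
    (hsign : ∀ ξ, 0 ≤ ξ → 0 < ε * d ξ) : ∃ J P, IsUnfolding d ε J P := by
  obtain ⟨M, hM⟩ := hbdd
  set e : ℝ → ℝ := fun ξ => ε * d (max ξ 0) with he_def
  have hec : Continuous e := continuous_const.mul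
    (hcont.comp_continuous (by fun_prop) fun ξ => le_max_right ξ 0)
  have hepos : ∀ ξ, 0 < e ξ := fun ξ => hsign _ (le_max_right ξ 0)
  have hd : ∀ ξ, 0 ≤ ξ → d ξ = ε * e ξ := fun ξ hξ => by
    simp only [he_def, max_eq_left hξ]; rw [← mul_assoc, hε, one_mul]
  have hεabs : |ε| = 1 := by
    have := abs_mul_abs_self ε
    rw [hε] at this
    nlinarith [abs_nonneg ε]
  have habs : ∀ ξ, 0 ≤ ξ → |d ξ| = e ξ := fun ξ hξ => by
    rw [hd ξ hξ, abs_mul, hεabs, one_mul, abs_of_pos (hepos ξ)]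
  have hεn : ‖(ε : ℂ)‖ₑ = 1 := by
    rw [← ofReal_norm, Complex.norm_real, Real.norm_eq_abs, hεabs, ENNReal.ofReal_one]
  have hεε : (ε : ℂ) * ε = 1 := by exact_mod_cast hε
  obtain ⟨p, hp0, hp, hq⟩ := exists_travelTime e hec hepos M fun ξ => by
    have := hM (max ξ 0) (le_max_right ξ 0)
    rw [habs _ (le_max_right ξ 0)] at this
    simpa [he_def] using this
  have hq0 : p.symm 0 = 0 := by rw [← hp0, p.symm_apply_apply, hp0]
  have hpnn : ∀ ξ, 0 ≤ p ξ ↔ 0 ≤ ξ := fun ξ => by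
    nth_rewrite 1 [← hp0]; exact p.le_iff_le
  have hqnn : ∀ s, 0 ≤ p.symm s ↔ 0 ≤ s := fun s => by
    nth_rewrite 1 [← hq0]; exact p.symm.le_iff_le
  have hpm : Measurable p := p.toHomeomorph.continuous.measurable
  have hqm : Measurable p.symm := p.symm.toHomeomorph.continuous.measurable
  have hpdiff : Differentiable ℝ p := fun ξ => (hp ξ).differentiableAt
  have hqdiff : Differentiable ℝ p.symm := fun s => (hq s).differentiableAt
  have hpim : p '' Set.Ici 0 = Set.Ici 0 := by rw [p.image_Ici, hp0]
  have hqim : p.symm '' Set.Ici 0 = Set.Ici 0 := by rw [p.symm.image_Ici, hq0]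
  have hw : ∀ f : ℝ → ENNReal, Measurable f →
      ∫⁻ ξ, f ξ ∂wMeasure d = ∫⁻ ξ in Set.Ici 0, ENNReal.ofReal (e ξ) * f ξ := fun f hf => by
    rw [wMeasure_eq habs, lintegral_withDensity_eq_lintegral_mul _
      hec.measurable.ennreal_ofReal hf]
    rfl
  have hofReal : ∀ r : ℝ, 0 < r → ‖(r : ℂ)‖ₑ = ENNReal.ofReal r := fun r hr => by
    rw [← ofReal_norm, Complex.norm_real, Real.norm_eq_abs, abs_of_pos hr]
  obtain ⟨J, hJ⟩ := exists_weightedComp volume (wMeasure d) p.symm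
    ((Set.Ici (0 : ℝ)).indicator fun s => (ε : ℂ) * (e (p.symm s) : ℂ)) hqm
    ((by fun_prop : Measurable fun s => (ε : ℂ) * (e (p.symm s) : ℂ)).indicator
      measurableSet_Ici) (by
      intro f hf
      rw [hw f hf]
      nth_rewrite 2 [← hqim]
      rw [lintegral_image_eq_lintegral_abs_deriv_mul measurableSet_Ici
        (fun s _ => (hq s).hasDerivWithinAt) p.symm.injective.injOn,
        ← lintegral_indicator measurableSet_Ici]
      refine lintegral_mono fun s => ?_
      by_cases hs : s ∈ Set.Ici (0 : ℝ)
      · simp only [Set.indicator_of_mem hs, enorm_mul, hεn, one_mul, hofReal _ (hepos _),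
          abs_of_pos (hepos _), sq, mul_assoc]
        exact le_rfl
      · simp [hs])
  obtain ⟨P, hP⟩ := exists_weightedComp (wMeasure d) volume p
    (fun ξ => (ε : ℂ) * ((e ξ)⁻¹ : ℝ)) hpm (by
      have := hec.measurable; fun_prop) (by
      intro f hf
      rw [hw _ (by have := hec.measurable; have := hf.comp hpm; fun_prop)]
      refine le_trans ?_ (setLIntegral_le_lintegral (Set.Ici 0) f)
      nth_rewrite 2 [← hpim]
      rw [lintegral_image_eq_lintegral_abs_deriv_mul measurableSet_Ici
        (fun ξ _ => (hp ξ).hasDerivWithinAt) p.injective.injOn]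
      refine lintegral_mono fun ξ => ?_
      have h1 : 0 < (e ξ)⁻¹ := inv_pos.2 (hepos ξ)
      simp only [enorm_mul, hεn, one_mul, hofReal _ h1, abs_of_pos h1]
      rw [sq, ← mul_assoc, ← mul_assoc, ← ENNReal.ofReal_mul (hepos ξ).le,
        mul_inv_cancel₀ (hepos ξ).ne', ENNReal.ofReal_one, one_mul])
  have hJnn : ∀ x : Lp ℂ 2 (wMeasure d), ∀ᵐ s, 0 ≤ s →
      (J x : ℝ → ℂ) s = (d (p.symm s) : ℂ) * (x : ℝ → ℂ) (p.symm s) := fun x => by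
    filter_upwards [hJ x] with s hs h0
    rw [hs, Set.indicator_of_mem (show s ∈ Set.Ici 0 from h0), hd _ ((hqnn s).2 h0)]
    push_cast; rfl
  have hJp : ∀ x : Lp ℂ 2 (wMeasure d), ∀ᵐ ξ, 0 ≤ ξ →
      (J x : ℝ → ℂ) (p ξ) = (d ξ : ℂ) * (x : ℝ → ℂ) ξ := fun x => by
    filter_upwards [ae_comp_symm_of_differentiable p.symm hqdiff (hJnn x)] with ξ hξ h0
    simpa using hξ ((hpnn ξ).2 h0)
  have haew : ∀ {Q : ℝ → Prop}, (∀ᵐ ξ ∂wMeasure d, Q ξ) ↔ ∀ᵐ ξ, 0 ≤ ξ → Q ξ :=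
    ae_wMeasure_iff habs hec.measurable hepos
  have himg : ∀ a b : ℝ, p '' Set.Ioc a b = Set.Ioc (p a) (p b) := fun a b => p.image_Ioc a b
  have hsub : ∀ (x : Lp ℂ 2 (wMeasure d)) (a b : ℝ), 0 ≤ a →
      (∀ᵐ ξ ∂volume.restrict (Set.Ioc a b), |(e ξ)⁻¹| • (J x : ℝ → ℂ) (p ξ) =
        (ε : ℂ) * (x : ℝ → ℂ) ξ) := fun x a b ha => by
    rw [ae_restrict_iff' measurableSet_Ioc]
    filter_upwards [hJp x] with ξ hξ hm
    have h0 : 0 ≤ ξ := ha.trans hm.1.le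
    rw [hξ h0, hd ξ h0, abs_of_pos (inv_pos.2 (hepos ξ)), Complex.real_smul]
    have : (e ξ : ℂ) ≠ 0 := by exact_mod_cast (hepos ξ).ne'
    push_cast
    field_simp
  have hint : ∀ (x : Lp ℂ 2 (wMeasure d)) (b : ℝ), 0 ≤ b →
      IntervalIntegrable (x : ℝ → ℂ) volume 0 b := fun x b hb => by
    rw [intervalIntegrable_iff_integrableOn_Ioc_of_le hb]
    have h1 : IntegrableOn (J x : ℝ → ℂ) (p '' Set.Ioc 0 b) := by
      rw [himg]
      exact (intervalIntegrable_iff_integrableOn_Ioc_of_le (p.monotone hb)).1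
        (Lp_two_intervalIntegrable (J x) _ _)
    rw [integrableOn_image_iff_integrableOn_abs_deriv_smul measurableSet_Ioc
      (fun ξ _ => (hp ξ).hasDerivWithinAt) p.injective.injOn] at h1
    have h2 := (Integrable.congr h1 (hsub x 0 b le_rfl)).const_mul (ε : ℂ)
    refine h2.congr (ae_of_all _ fun ξ => ?_)
    simp only [← mul_assoc, hεε, one_mul]
  have hCV : ∀ (x : Lp ℂ 2 (wMeasure d)) (b : ℝ), 0 ≤ b →
      ∫ ζ in (0 : ℝ)..b, (x : ℝ → ℂ) ζ = ε * primCLM (p b) (J x) := fun x b hb => by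
    rw [primCLM_apply, intervalIntegral.integral_of_le hb,
      intervalIntegral.integral_of_le ((hpnn b).2 hb)]
    nth_rewrite 2 [← hp0]
    rw [← himg, integral_image_eq_integral_abs_deriv_smul measurableSet_Ioc
      (fun ξ _ => (hp ξ).hasDerivWithinAt) p.injective.injOn,
      integral_congr_ae (hsub x 0 b le_rfl), integral_const_mul, ← mul_assoc, hεε, one_mul]
  refine ⟨J, P, ?_, ?_, ?_, ?_, ?_⟩
  · intro x b hb
    rw [primCLM_apply, intervalIntegral.integral_congr_ae (g := fun _ => (0 : ℂ))]
    · simp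
    · filter_upwards [hJ x, Measure.ae_ne volume (0 : ℝ)] with s hs hs0 hm
      rw [Set.uIoc_of_ge hb] at hm
      rw [hs, Set.indicator_of_notMem (by simpa using lt_of_le_of_ne hm.2 hs0), zero_mul]
  · intro w b hb
    refine primCLM_congr ?_
    have h1 := ae_comp_symm_of_differentiable p hpdiff (haew.1 (hP w))
    filter_upwards [hJnn (P w), h1] with s hs h2 hm
    rw [Set.uIoc_of_le hb] at hm
    have hq' := (hqnn s).2 hm.1.le
    rw [hs hm.1.le, h2 hq', hd _ hq', p.apply_symm_apply]
    have : (e (p.symm s) : ℂ) ≠ 0 := by exact_mod_cast (hepos _).ne'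
    push_cast
    field_simp
    rw [sq, hεε, one_mul]
  · intro x hx
    rw [Lp.eq_zero_iff_ae_eq_zero]
    refine haew.2 ?_
    have h1 := ae_comp_symm_of_differentiable p.symm hqdiff
      (ae_eq_zero_of_primCLM_eq_zero hx)
    filter_upwards [hJp x, h1] with ξ hξ h2 h0
    have h3 := h2 (by simpa using (hpnn ξ).2 h0)
    rw [OrderIso.symm_symm, hξ h0] at h3
    refine (mul_eq_zero.1 h3).resolve_left ?_
    have := hsign ξ h0
    intro h
    simp only [Complex.ofReal_eq_zero] at h
    simp [h] at this
  · rintro x y g ⟨h1, h2, h3, h4⟩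
    have hg := (memLp_wMeasure_iff habs hec.measurable hepos).2 ⟨h2, h3⟩
    have hLg : ∀ᵐ ξ, 0 ≤ ξ → (hg.toLp g : ℝ → ℂ) ξ = g ξ := haew.1 hg.coeFn_toLp
    refine ⟨hg.toLp g, (ae_restrict_iff' measurableSet_Ici).2 hLg, ?_⟩
    have h1' := ae_comp_symm_of_differentiable p hpdiff
      ((ae_restrict_iff' measurableSet_Ici).1 h1)
    filter_upwards [hJnn x, h1'] with s hs h5 h0
    have hq' := (hqnn s).2 h0
    rw [hs h0, ← h5 hq', ← sub_eq_iff_eq_add', h4 0 Set.self_mem_Ici _ hq',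
      ← p.apply_symm_apply s, ← hCV _ _ (by simpa using hq'), p.apply_symm_apply]
    refine intervalIntegral.integral_congr_ae ?_
    filter_upwards [hLg] with ξ hξ hm
    rw [Set.uIoc_of_le hq'] at hm
    exact (hξ hm.1.le).symm
  · intro x L c h
    refine ⟨fun ξ => c + ∫ ζ in (0 : ℝ)..ξ, (L : ℝ → ℂ) ζ, by simp, ?_, ?_, ?_, ?_⟩
    · rw [ae_restrict_iff' measurableSet_Ici]
      filter_upwards [hJp x, ae_comp_symm_of_differentiable p.symm hqdiff h] with ξ h1 h2 h0
      rw [← h1 h0, hCV L ξ h0]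
      exact (h2 ((hpnn ξ).2 h0)).symm
    · exact ((memLp_wMeasure_iff habs hec.measurable hepos).1 (Lp.memLp L)).1
    · exact ((memLp_wMeasure_iff habs hec.measurable hepos).1 (Lp.memLp L)).2
    · intro a ha b hb
      rw [add_sub_add_left_eq_sub,
        intervalIntegral.integral_interval_sub_left (hint L b hb) (hint L a ha)]

end Unfolding

section AbstractSemigroup

variable {H : Type*} [NormedAddCommGroup H] [NormedSpace ℂ H]

/-- If `u t` is weakly the integral of the continuous curve `f` over `[0, t]`, then
`u t / t → f 0`. -/
theorem tendsto_inv_smul_of_weak_integral [CompleteSpace H] {ι : Type*} (ell : ι → H →L[ℂ] ℂ)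
    (hsep : ∀ x, (∀ i, ell i x = 0) → x = 0) (f u : ℝ → H) (hf : Continuous f)
    (hu : ∀ t, 0 < t → ∀ i, ell i (u t) = ∫ r in (0 : ℝ)..t, ell i (f r)) :
    Tendsto (fun t : ℝ => (t : ℂ)⁻¹ • u t) (𝓝[>] (0 : ℝ)) (𝓝 (f 0)) := by
  have hu' : ∀ t, 0 < t → u t = ∫ r in (0 : ℝ)..t, f r := fun t ht => by
    rw [← sub_eq_zero]
    refine hsep _ fun i => ?_
    rw [map_sub, hu t ht i, (ell i).intervalIntegral_comp_comm (hf.intervalIntegrable 0 t),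
      sub_self]
  have hd : HasDerivAt (fun t => ∫ r in (0 : ℝ)..t, f r) (f 0) 0 :=
    (hf.integral_hasStrictDerivAt 0 0).hasDerivAt
  have h2 := (hasDerivWithinAt_iff_tendsto_slope' (s := Set.Ioi 0)
    Set.self_notMem_Ioi).1 hd.hasDerivWithinAt
  refine h2.congr' ?_
  filter_upwards [self_mem_nhdsWithin] with t ht
  rw [slope_def_module, intervalIntegral.integral_same, sub_zero, sub_zero, hu' t ht,
    ← Complex.ofReal_inv, Complex.coe_smul]

/-- A semigroup acts by exponentials on eigenvectors of its generator. -/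
theorem semigroup_eigenvector (T : ℝ → H →L[ℂ] H) (h0 : T 0 = ContinuousLinearMap.id ℂ H)
    (hadd : ∀ s t : ℝ, 0 ≤ s → 0 ≤ t → T (t + s) = (T t).comp (T s)) (x : H)
    (hcont : ContinuousOn (fun t => T t x) (Set.Ici 0)) (c : ℝ)
    (hx : Tendsto (fun t : ℝ => (t : ℂ)⁻¹ • (T t x - x)) (𝓝[>] (0 : ℝ)) (𝓝 ((c : ℂ) • x)))
    (t : ℝ) (ht : 0 ≤ t) : T t x = (Real.exp (c * t) : ℂ) • x := by
  have hderiv : ∀ s, 0 ≤ s → HasDerivWithinAt (fun t => T t x) (c • T s x) (Set.Ici s) s := by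
    intro s hs
    rw [← hasDerivWithinAt_Ioi_iff_Ici, hasDerivWithinAt_iff_tendsto_slope' Set.self_notMem_Ioi]
    have hshift : Tendsto (fun r => r - s) (𝓝[>] s) (𝓝[>] 0) := by
      refine tendsto_nhdsWithin_iff.2 ⟨?_, ?_⟩
      · have : Tendsto (fun r => r - s) (𝓝 s) (𝓝 (s - s)) :=
          (continuous_id.sub continuous_const).tendsto s
        rw [sub_self] at this
        exact this.mono_left nhdsWithin_le_nhds
      · filter_upwards [self_mem_nhdsWithin] with r hr
        exact sub_pos.2 (mem_Ioi.1 hr)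
    have h1 := ((T s).continuous.tendsto _).comp (hx.comp hshift)
    rw [map_smul, Complex.coe_smul] at h1
    refine h1.congr' ?_
    filter_upwards [self_mem_nhdsWithin] with r hr
    have hr' : 0 ≤ r - s := (sub_pos.2 (mem_Ioi.1 hr)).le
    have h2 : T r x = T s (T (r - s) x) := by
      have := hadd (r - s) s hr' hs
      rw [add_sub_cancel] at this
      rw [this]; rfl
    simp only [Function.comp_apply]
    rw [map_smul, map_sub, ← h2, slope_def_module, ← Complex.ofReal_inv, Complex.coe_smul]
  have hconst := constant_of_has_deriv_right_zero (a := 0) (b := t)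
    (f := fun t => Real.exp (-(c * t)) • T t x) (by
      have hexp : Continuous fun t : ℝ => Real.exp (-(c * t)) := by fun_prop
      exact hexp.continuousOn.smul (hcont.mono fun r hr => hr.1)) (by
      intro s hs
      have h1 : HasDerivWithinAt (fun t : ℝ => Real.exp (-(c * t)))
          (Real.exp (-(c * s)) * -(c * 1)) (Set.Ici s) s :=
        (((hasDerivAt_id s).const_mul c).neg.exp).hasDerivWithinAt
      have h2 := h1.smul (hderiv s hs.1)
      rw [smul_smul, ← add_smul, mul_one, mul_neg, add_neg_cancel, zero_smul] at h2
      exact h2) t ⟨ht, le_rfl⟩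
  simp only [mul_zero, neg_zero, Real.exp_zero, one_smul, h0,
    ContinuousLinearMap.id_apply] at hconst
  rw [Complex.coe_smul]
  nth_rewrite 2 [← hconst]
  rw [smul_smul, ← Real.exp_add]
  simp

end AbstractSemigroup

section CoupledShifts

local notation "L2R" => Lp ℂ 2 (volume : Measure ℝ)

variable {np nm : ℕ} {δ : Fin np ⊕ Fin nm → ℝ → ℝ}

/-- The transport direction of each component. -/
def dirSign (k : Fin np ⊕ Fin nm) : ℝ := Sum.elim (fun _ => 1) (fun _ => -1) k

theorem dirSign_mul_self (k : Fin np ⊕ Fin nm) : dirSign k * dirSign k = 1 := by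
  cases k <;> simp [dirSign]

variable (J : ∀ k, Lp ℂ 2 (wMeasure (δ k)) →L[ℂ] L2R)
  (P : ∀ k, L2R →L[ℂ] Lp ℂ 2 (wMeasure (δ k))) (R : Matrix (Fin nm) (Fin np) ℂ)

/-- The `k`-th component in unfolded coordinates. -/
noncomputable def compCLM (k : Fin np ⊕ Fin nm) : HSp δ →L[ℂ] L2R :=
  (J k).comp (PiLp.proj 2 (fun k => Lp ℂ 2 (wMeasure (δ k))) k)

theorem compCLM_apply (k : Fin np ⊕ Fin nm) (x : HSp δ) : compCLM J k x = J k (x k) := rfl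

/-- The unfolded profile: inflow components are continued to the negative half-line by the
reflected boundary input. -/
noncomputable def profileCLM (k : Fin np ⊕ Fin nm) : HSp δ →L[ℂ] L2R :=
  Sum.elim (fun k => compCLM J (.inl k))
    (fun j => compCLM J (.inr j) + ∑ k, R j k • reflCLM.comp (compCLM J (.inl k))) k

/-- The semigroup of coupled shifts. -/
noncomputable def shiftSemigroup (t : ℝ) : HSp δ →L[ℂ] HSp δ :=
  (PiLp.continuousLinearEquiv 2 ℂ fun k => Lp ℂ 2 (wMeasure (δ k))).symm.toContinuousLinearMap.comp
    (ContinuousLinearMap.pi fun k =>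
      (P k).comp ((transCLM (dirSign k * t)).comp (profileCLM J R k)))

theorem shiftSemigroup_apply (t : ℝ) (x : HSp δ) (k : Fin np ⊕ Fin nm) :
    shiftSemigroup J P R t x k = P k (transCLM (dirSign k * t) (profileCLM J R k x)) := rfl

theorem continuous_shiftSemigroup (x : HSp δ) :
    Continuous fun t => shiftSemigroup J P R t x := by
  refine (PiLp.continuous_toLp 2 _).comp (continuous_pi fun k => (P k).continuous.comp ?_)
  exact (continuous_transCLM (profileCLM J R k x)).comp (continuous_const.mul continuous_id)

/-- The functional `x ↦ ∫₀ᵇ J x k`. -/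
noncomputable def compPrim (k : Fin np ⊕ Fin nm) (b : ℝ) : HSp δ →L[ℂ] ℂ :=
  (primCLM b).comp (compCLM J k)

theorem compPrim_apply (k : Fin np ⊕ Fin nm) (b : ℝ) (x : HSp δ) :
    compPrim J k b x = primCLM b (J k (x k)) := rfl

/-- The functional `x ↦ ∫₀ᵘ` of the unfolded profile. -/
noncomputable def profPrim (k : Fin np ⊕ Fin nm) (u : ℝ) : HSp δ →L[ℂ] ℂ :=
  (primCLM u).comp (profileCLM J R k)

theorem profPrim_inl (k : Fin np) (u : ℝ) (x : HSp δ) :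
    profPrim J R (.inl k) u x = compPrim J (.inl k) u x := rfl

theorem profPrim_inr (j : Fin nm) (u : ℝ) (x : HSp δ) :
    profPrim J R (.inr j) u x =
      compPrim J (.inr j) u x - ∑ k, R j k * compPrim J (.inl k) (-u) x := by
  simp [profPrim, profileCLM, compPrim_apply, compCLM_apply, primCLM_reflCLM, sub_eq_add_neg]

theorem profPrim_zero (k : Fin np ⊕ Fin nm) (x : HSp δ) : profPrim J R k 0 x = 0 :=
  primCLM_zero _

theorem continuous_profPrim (k : Fin np ⊕ Fin nm) (x : HSp δ) :
    Continuous fun u => profPrim J R k u x := continuous_primCLM _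

/-- The range of arguments on which the profile of the `k`-th component is meaningful. -/
def Relevant (k : Fin np ⊕ Fin nm) (u : ℝ) : Prop :=
  Sum.elim (fun _ => 0 ≤ u) (fun _ => True) k

theorem relevant_of_nonneg {k : Fin np ⊕ Fin nm} {u : ℝ} (hu : 0 ≤ u) : Relevant k u := by
  cases k <;> simp [Relevant, hu]

theorem relevant_add {k : Fin np ⊕ Fin nm} {b t : ℝ} (hb : 0 ≤ b) (ht : 0 ≤ t) :
    Relevant k (b + dirSign k * t) := by
  cases k <;> simp [Relevant, dirSign]
  positivity

theorem relevant_dirSign_mul {k : Fin np ⊕ Fin nm} {t : ℝ} (ht : 0 ≤ t) :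
    Relevant k (dirSign k * t) := by
  cases k <;> simp [Relevant, dirSign, ht]

variable {J P} (hJP : ∀ k, IsUnfolding (δ k) (dirSign k) (J k) (P k))
include hJP

theorem compPrim_of_nonpos (k : Fin np ⊕ Fin nm) {b : ℝ} (hb : b ≤ 0) (x : HSp δ) :
    compPrim J k b x = 0 := (hJP k).prim_of_nonpos _ _ hb

theorem profPrim_of_nonneg (k : Fin np ⊕ Fin nm) {b : ℝ} (hb : 0 ≤ b) (x : HSp δ) :
    profPrim J R k b x = compPrim J k b x := by
  cases k with
  | inl k => rfl
  | inr j => simp [profPrim_inr, compPrim_of_nonpos hJP _ (neg_nonpos.2 hb)]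

theorem compPrim_shiftSemigroup (k : Fin np ⊕ Fin nm) {b : ℝ} (hb : 0 ≤ b) (t : ℝ) (x : HSp δ) :
    compPrim J k b (shiftSemigroup J P R t x) =
      profPrim J R k (b + dirSign k * t) x - profPrim J R k (dirSign k * t) x := by
  rw [compPrim_apply, shiftSemigroup_apply, (hJP k).prim_fold _ _ hb, primCLM_transCLM]
  rfl

theorem profPrim_shiftSemigroup (k : Fin np ⊕ Fin nm) {u s : ℝ} (hu : Relevant k u) (hs : 0 ≤ s)
    (x : HSp δ) : profPrim J R k u (shiftSemigroup J P R s x) =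
      profPrim J R k (u + dirSign k * s) x - profPrim J R k (dirSign k * s) x := by
  rcases le_total 0 u with h0 | h0
  · rw [profPrim_of_nonneg R hJP k h0, compPrim_shiftSemigroup R hJP k h0]
  cases k with
  | inl k =>
    obtain rfl : u = 0 := le_antisymm h0 hu
    simp [profPrim_zero]
  | inr j =>
    have h1 : u + -s ≤ 0 := by linarith
    have h2 : -s ≤ 0 := by linarith
    have h3 : -(u + -s) = -u + s := by ring
    simp only [profPrim_inr, compPrim_of_nonpos hJP _ h0,
      compPrim_shiftSemigroup R hJP _ (neg_nonneg.2 h0), profPrim_inl, dirSign, Sum.elim_inl,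
      Sum.elim_inr, one_mul, neg_mul, compPrim_of_nonpos hJP _ h1, compPrim_of_nonpos hJP _ h2,
      h3, neg_neg, mul_sub, Finset.sum_sub_distrib]
    ring

theorem eq_of_compPrim_eq {x y : HSp δ}
    (h : ∀ k b, 0 ≤ b → compPrim J k b x = compPrim J k b y) : x = y := by
  ext1 k
  rw [← sub_eq_zero]
  refine (hJP k).separating _ fun b hb => ?_
  rw [map_sub, map_sub, sub_eq_zero]
  exact h k b hb

theorem shiftSemigroup_zero : shiftSemigroup J P R 0 = ContinuousLinearMap.id ℂ (HSp δ) := by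
  ext1 x
  refine eq_of_compPrim_eq hJP fun k b hb => ?_
  rw [compPrim_shiftSemigroup R hJP k hb, mul_zero, add_zero, profPrim_zero, sub_zero,
    profPrim_of_nonneg R hJP k hb]
  rfl

theorem shiftSemigroup_add {s t : ℝ} (hs : 0 ≤ s) (ht : 0 ≤ t) :
    shiftSemigroup J P R (t + s) = (shiftSemigroup J P R t).comp (shiftSemigroup J P R s) := by
  ext1 x
  refine eq_of_compPrim_eq hJP fun k b hb => ?_
  rw [ContinuousLinearMap.comp_apply, compPrim_shiftSemigroup R hJP k hb,
    compPrim_shiftSemigroup R hJP k hb, profPrim_shiftSemigroup R hJP k (relevant_add hb ht) hs,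
    profPrim_shiftSemigroup R hJP k (relevant_dirSign_mul ht) hs, mul_add, add_assoc]
  ring

omit hJP in
/-- The generator relation `L = A x` in unfolded coordinates, with boundary values `c`. -/
def UnfoldedDom (J : ∀ k, Lp ℂ 2 (wMeasure (δ k)) →L[ℂ] L2R) (x L : HSp δ)
    (c : Fin np ⊕ Fin nm → ℂ) : Prop :=
  ∀ k, ∀ᵐ s, 0 ≤ s → (J k (x k) : ℝ → ℂ) s = c k + dirSign k * primCLM s (J k (L k))

theorem compPrim_eq_of_unfoldedDom {x L : HSp δ} {c : Fin np ⊕ Fin nm → ℂ}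
    (h : UnfoldedDom J x L c) (k : Fin np ⊕ Fin nm) {b : ℝ} (hb : 0 ≤ b) :
    compPrim J k b x = ∫ s in (0 : ℝ)..b, (c k + dirSign k * profPrim J R k s L) := by
  rw [compPrim_apply, primCLM_apply]
  refine intervalIntegral.integral_congr_ae ?_
  filter_upwards [h k] with s hs hm
  rw [Set.uIoc_of_le hb] at hm
  rw [hs hm.1.le, profPrim_of_nonneg R hJP k hm.1.le, compPrim_apply]

theorem profPrim_eq_of_unfoldedDom {x L : HSp δ} {c : Fin np ⊕ Fin nm → ℂ}
    (h : UnfoldedDom J x L c) (hc : ∀ j, c (.inr j) = ∑ k, R j k * c (.inl k))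
    (k : Fin np ⊕ Fin nm) {u : ℝ} (hu : Relevant k u) :
    profPrim J R k u x = ∫ s in (0 : ℝ)..u, (c k + dirSign k * profPrim J R k s L) := by
  rcases le_total 0 u with h0 | h0
  · rw [profPrim_of_nonneg R hJP k h0, compPrim_eq_of_unfoldedDom R hJP h k h0]
  cases k with
  | inl k =>
    obtain rfl : u = 0 := le_antisymm h0 hu
    simp [profPrim_zero]
  | inr j =>
    have hint : ∀ k, IntervalIntegrable
        (fun s => R j k * (c (.inl k) + dirSign (np := np) (nm := nm) (.inl k) *
          profPrim J R (.inl k) s L)) volume 0 (-u) := fun k => by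
      have := continuous_profPrim J R (.inl k) L
      exact Continuous.intervalIntegrable (by fun_prop) _ _
    have hrev : ∫ s in (0 : ℝ)..u, (c (.inr j) + (dirSign (np := np) (nm := nm) (.inr j) : ℂ) *
          profPrim J R (.inr j) s L) =
        -∫ s in (0 : ℝ)..-u, (c (.inr j) + (dirSign (np := np) (nm := nm) (.inr j) : ℂ) *
          profPrim J R (.inr j) (-s) L) := by
      rw [intervalIntegral.integral_comp_neg fun s => c (.inr j) +
        (dirSign (np := np) (nm := nm) (.inr j) : ℂ) * profPrim J R (.inr j) s L, neg_neg,
        neg_zero, intervalIntegral.integral_symm u 0]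
    rw [hrev, profPrim_inr, compPrim_of_nonpos hJP _ h0, zero_sub, neg_inj]
    simp_rw [compPrim_eq_of_unfoldedDom R hJP h _ (neg_nonneg.2 h0),
      ← intervalIntegral.integral_const_mul]
    rw [← intervalIntegral.integral_finsetSum fun k _ => hint k]
    refine intervalIntegral.integral_congr fun s hs => ?_
    rw [Set.uIcc_of_le (neg_nonneg.2 h0)] at hs
    simp only [profPrim_inr, compPrim_of_nonpos hJP _ (neg_nonpos.2 hs.1), dirSign, hc,
      Sum.elim_inl, Sum.elim_inr, profPrim_inl, neg_neg, zero_sub, mul_add,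
      Finset.sum_add_distrib, Complex.ofReal_one, Complex.ofReal_neg, one_mul, neg_mul]

theorem tendsto_of_unfoldedDom {x L : HSp δ} {c : Fin np ⊕ Fin nm → ℂ}
    (h : UnfoldedDom J x L c) (hc : ∀ j, c (.inr j) = ∑ k, R j k * c (.inl k)) :
    Tendsto (fun t : ℝ => (t : ℂ)⁻¹ • (shiftSemigroup J P R t x - x)) (𝓝[>] (0 : ℝ)) (𝓝 L) := by
  have h0 : shiftSemigroup J P R 0 L = L := by
    rw [shiftSemigroup_zero R hJP]; rfl
  rw [← h0]
  refine tendsto_inv_smul_of_weak_integral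
    (ι := (Fin np ⊕ Fin nm) × {b : ℝ // 0 ≤ b}) (fun i => compPrim J i.1 i.2)
    (fun y hy => eq_of_compPrim_eq hJP fun k b hb => by
      rw [map_zero]; exact hy (k, ⟨b, hb⟩))
    (fun t => shiftSemigroup J P R t L) _ (continuous_shiftSemigroup J P R L) ?_
  rintro t ht ⟨k, b, hb⟩
  simp only [map_sub, compPrim_shiftSemigroup R hJP k hb]
  set yh : ℝ → ℂ := fun s => c k + dirSign k * profPrim J R k s L with hyh
  have hyc : Continuous yh := by
    have := continuous_profPrim J R k L
    fun_prop
  have hY : ∀ u, HasDerivAt (fun v => ∫ s in (0 : ℝ)..v, yh s) (yh u) u := fun u =>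
    (hyc.integral_hasStrictDerivAt 0 u).hasDerivAt
  have hpr : ∀ u, Relevant k u → profPrim J R k u x = ∫ s in (0 : ℝ)..u, yh s := fun u hu =>
    profPrim_eq_of_unfoldedDom R hJP h hc k hu
  have hε : (dirSign k : ℂ) * dirSign k = 1 := by exact_mod_cast dirSign_mul_self k
  have hlin : ∀ a r, HasDerivAt (fun r => a + dirSign k * r) (dirSign k) r := fun a r => by
    simpa using ((hasDerivAt_id r).const_mul (dirSign k)).const_add a
  have hder : ∀ r, HasDerivAt
      (fun r => (∫ s in (0 : ℝ)..b + dirSign k * r, yh s) -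
        ∫ s in (0 : ℝ)..0 + dirSign k * r, yh s)
      (profPrim J R k (b + dirSign k * r) L - profPrim J R k (dirSign k * r) L) r := fun r => by
    have h1 := (hY (b + dirSign k * r)).scomp r (hlin b r)
    have h2 := (hY (0 + dirSign k * r)).scomp r (hlin 0 r)
    refine (h1.sub h2).congr_deriv ?_
    simp only [hyh, Complex.real_smul, zero_add]
    linear_combination (profPrim J R k (b + dirSign k * r) L -
      profPrim J R k (dirSign k * r) L) * hε
  have hcd : Continuous fun r =>
      profPrim J R k (b + dirSign k * r) L - profPrim J R k (dirSign k * r) L := by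
    have := continuous_profPrim J R k L
    fun_prop
  rw [intervalIntegral.integral_eq_sub_of_hasDerivAt (fun r _ => hder r)
    (hcd.intervalIntegrable 0 t), hpr _ (relevant_add hb ht.le),
    hpr _ (relevant_dirSign_mul ht.le), ← profPrim_of_nonneg R hJP k hb,
    hpr _ (relevant_of_nonneg hb)]
  simp

theorem exists_unfoldedDom_of_tendsto {x L : HSp δ}
    (h : Tendsto (fun t : ℝ => (t : ℂ)⁻¹ • (shiftSemigroup J P R t x - x)) (𝓝[>] (0 : ℝ))
      (𝓝 L)) :
    ∃ c, UnfoldedDom J x L c ∧ ∀ j, c (.inr j) = ∑ k, R j k * c (.inl k) := by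
  have hε : ∀ k : Fin np ⊕ Fin nm, (dirSign k : ℂ) * dirSign k = 1 := fun k => by
    exact_mod_cast dirSign_mul_self k
  have hell : ∀ k b, 0 ≤ b → Tendsto (fun t : ℝ => (t : ℂ)⁻¹ *
      (profPrim J R k (b + dirSign k * t) x - profPrim J R k (dirSign k * t) x -
        profPrim J R k b x)) (𝓝[>] (0 : ℝ)) (𝓝 (compPrim J k b L)) := fun k b hb => by
    have := ((compPrim J k b).continuous.tendsto L).comp h
    refine this.congr fun t => ?_
    simp only [Function.comp_apply, map_smul, map_sub, smul_eq_mul,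
      compPrim_shiftSemigroup R hJP k hb, profPrim_of_nonneg R hJP k hb]
  have hdiff : ∀ k, ∀ᵐ b, 0 ≤ b → Tendsto (fun t : ℝ => (t : ℂ)⁻¹ *
      (profPrim J R k (b + dirSign k * t) x - profPrim J R k b x)) (𝓝[>] (0 : ℝ))
      (𝓝 (dirSign k * (J k (x k) : ℝ → ℂ) b)) := fun k => by
    filter_upwards [ae_hasDerivAt_primCLM (J k (x k)), Measure.ae_ne volume (0 : ℝ)]
      with b hb hb0 hb'
    have hpos : 0 < b := lt_of_le_of_ne hb' hb0.symm
    have h1 : HasDerivAt (fun b => profPrim J R k b x) ((J k (x k) : ℝ → ℂ) b) b :=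
      hb.congr_of_eventuallyEq ((lt_mem_nhds hpos).mono fun b hb =>
        profPrim_of_nonneg R hJP k hb.le x)
    have hlin : HasDerivAt (fun r => b + dirSign k * r) (dirSign k) 0 := by
      simpa using ((hasDerivAt_id (0 : ℝ)).const_mul (dirSign k)).const_add b
    have h2 := HasDerivAt.scomp (0 : ℝ) (by simpa using h1) hlin
    have h3 := (hasDerivWithinAt_iff_tendsto_slope' (s := Set.Ioi 0)
      Set.self_notMem_Ioi).1 h2.hasDerivWithinAt
    rw [Complex.real_smul] at h3
    refine h3.congr fun t => ?_
    simp [slope_def_module]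
  have hzero : ∀ k, ∃ c, (∀ᵐ b, 0 ≤ b → (J k (x k) : ℝ → ℂ) b =
      c + dirSign k * compPrim J k b L) ∧ Tendsto (fun t : ℝ => (t : ℂ)⁻¹ *
      profPrim J R k (dirSign k * t) x) (𝓝[>] (0 : ℝ)) (𝓝 (dirSign k * c)) := fun k => by
    have hlim : ∀ᵐ b, 0 ≤ b → Tendsto (fun t : ℝ => (t : ℂ)⁻¹ *
        profPrim J R k (dirSign k * t) x) (𝓝[>] (0 : ℝ))
        (𝓝 (dirSign k * (J k (x k) : ℝ → ℂ) b - compPrim J k b L)) := by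
      filter_upwards [hdiff k] with b hb h0
      refine ((hb h0).sub (hell k b h0)).congr fun t => ?_
      ring
    have hne : ∃ᵐ b : ℝ, 0 ≤ b := by
      rw [frequently_ae_iff]
      change volume (Set.Ici (0 : ℝ)) ≠ 0
      simp
    obtain ⟨b₀, hb₀, hb₀'⟩ := (hne.and_eventually hlim).exists
    refine ⟨dirSign k * (dirSign k * (J k (x k) : ℝ → ℂ) b₀ - compPrim J k b₀ L), ?_, ?_⟩
    · filter_upwards [hlim] with b hb h0
      have := tendsto_nhds_unique (hb h0) (hb₀' hb₀)
      rw [← this]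
      linear_combination (-(J k (x k) : ℝ → ℂ) b) * hε k
    · rw [← mul_assoc, hε, one_mul]
      exact hb₀' hb₀
  choose c hc1 hc2 using hzero
  refine ⟨c, hc1, fun j => ?_⟩
  have h1 := hc2 (.inr j)
  have h2 : Tendsto (fun t : ℝ => -∑ k, R j k * ((t : ℂ)⁻¹ * profPrim J R (.inl k)
      (dirSign (np := np) (nm := nm) (.inl k) * t) x)) (𝓝[>] (0 : ℝ))
      (𝓝 (-∑ k, R j k * (dirSign (np := np) (nm := nm) (.inl k) * c (.inl k)))) :=
    (tendsto_finsetSum _ fun k _ => (hc2 (.inl k)).const_mul (R j k)).neg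
  have h3 := tendsto_nhds_unique_of_eventuallyEq h1 h2 (by
    filter_upwards [self_mem_nhdsWithin] with t ht
    have ht' : -t ≤ 0 := neg_nonpos.2 (mem_Ioi.1 ht).le
    simp only [profPrim_inr, profPrim_inl, dirSign, Sum.elim_inl, Sum.elim_inr, one_mul, neg_mul,
      compPrim_of_nonpos hJP _ ht', zero_sub, neg_neg, mul_neg, Finset.mul_sum]
    congr 1
    exact Finset.sum_congr rfl fun k _ => by ring)
  simpa [dirSign] using h3

end CoupledShifts

section Generation

local notation "L2R" => Lp ℂ 2 (volume : Measure ℝ)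

theorem exists_unfoldings {np nm : ℕ} (δ : Fin np ⊕ Fin nm → ℝ → ℝ)
    (hcont : ∀ k, ContinuousOn (δ k) (Set.Ici 0))
    (hbdd : ∀ k, ∃ M : ℝ, ∀ ξ ∈ Set.Ici (0 : ℝ), |δ k ξ| ≤ M)
    (hpos : ∀ k : Fin np, ∀ ξ ∈ Set.Ici (0 : ℝ), 0 < δ (Sum.inl k) ξ)
    (hneg : ∀ j : Fin nm, ∀ ξ ∈ Set.Ici (0 : ℝ), δ (Sum.inr j) ξ < 0) :
    ∃ (J : ∀ k, Lp ℂ 2 (wMeasure (δ k)) →L[ℂ] L2R) (P : ∀ k, L2R →L[ℂ] Lp ℂ 2 (wMeasure (δ k))),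
      ∀ k, IsUnfolding (δ k) (dirSign k) (J k) (P k) := by
  choose J P h using fun k => exists_isUnfolding (δ k) (dirSign k) (dirSign_mul_self k) (hcont k)
    (hbdd k) fun ξ hξ => by
      cases k with
      | inl k => simpa [dirSign] using hpos k ξ hξ
      | inr j => simpa [dirSign] using hneg j ξ hξ
  exact ⟨J, P, h⟩

variable {np nm : ℕ} {δ : Fin np ⊕ Fin nm → ℝ → ℝ}
  {J : ∀ k, Lp ℂ 2 (wMeasure (δ k)) →L[ℂ] L2R} {P : ∀ k, L2R →L[ℂ] Lp ℂ 2 (wMeasure (δ k))}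
  (hJP : ∀ k, IsUnfolding (δ k) (dirSign k) (J k) (P k))
  {K : Matrix (Fin nm) (Fin nm) ℂ} {Q : Matrix (Fin nm) (Fin np) ℂ}
include hJP

theorem exists_unfoldedDom_of_inDom {x : HSp δ} {y g : Fin np ⊕ Fin nm → ℝ → ℂ}
    (h : InDom δ K Q x y g) : ∃ L : HSp δ,
      (∀ k, (L k : ℝ → ℂ) =ᵐ[volume.restrict (Set.Ici 0)] g k) ∧
        UnfoldedDom J x L fun k => y k 0 := by
  obtain ⟨h1, h2, h3, h4, -⟩ := h
  choose L hL using fun k => (hJP k).of_pair (x k) (y k) (g k) ⟨h1 k, h2 k, h3 k, h4 k⟩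
  exact ⟨WithLp.toLp 2 L, fun k => (hL k).1, fun k => (hL k).2⟩

theorem exists_inDom_of_unfoldedDom {x L : HSp δ} {c : Fin np ⊕ Fin nm → ℂ}
    (h : UnfoldedDom J x L c)
    (hc : K.mulVec (fun j => c (.inr j)) + Q.mulVec (fun k => c (.inl k)) = 0) :
    ∃ y, InDom δ K Q x y fun k => L k := by
  choose y hy0 hy using fun k => (hJP k).to_pair (x k) (L k) (c k) (h k)
  refine ⟨y, fun k => (hy k).1, fun k => (hy k).2.1, fun k => (hy k).2.2.1,
    fun k => (hy k).2.2.2, ?_⟩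
  simpa only [hy0] using hc

omit hJP in
theorem boundary_iff (hK : IsUnit K) (c : Fin np ⊕ Fin nm → ℂ) :
    K.mulVec (fun j => c (.inr j)) + Q.mulVec (fun k => c (.inl k)) = 0 ↔
      ∀ j, c (.inr j) = ∑ k, (-(K⁻¹ * Q)) j k * c (.inl k) := by
  have hdet := (Matrix.isUnit_iff_isUnit_det K).1 hK
  have hR : (∀ j, c (.inr j) = ∑ k, (-(K⁻¹ * Q)) j k * c (.inl k)) ↔
      (fun j => c (.inr j)) = (-(K⁻¹ * Q)).mulVec fun k => c (.inl k) := by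
    simp only [funext_iff, Matrix.mulVec, dotProduct]
  rw [hR, Matrix.neg_mulVec, ← Matrix.mulVec_mulVec]
  constructor
  · intro h
    rw [eq_neg_of_add_eq_zero_right h, Matrix.mulVec_neg, Matrix.mulVec_mulVec,
      Matrix.nonsing_inv_mul K hdet, Matrix.one_mulVec, neg_neg]
  · intro h
    rw [h, Matrix.mulVec_neg, Matrix.mulVec_mulVec, Matrix.mul_nonsing_inv K hdet,
      Matrix.one_mulVec, neg_add_cancel]

omit hJP in
theorem eq_of_ae_eq_restrict {x y : HSp δ}
    (h : ∀ k, (x k : ℝ → ℂ) =ᵐ[volume.restrict (Set.Ici 0)] y k) : x = y := by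
  ext1 k
  exact Lp.ext ((withDensity_absolutelyContinuous _ _).ae_le (h k))

omit hJP in
theorem exists_L2_exp {lam : ℝ} (hlam : 0 < lam) :
    ∃ w : L2R, ∀ᵐ s, 0 ≤ s → (w : ℝ → ℂ) s = Real.exp (-(lam * s)) := by
  set f : ℝ → ℂ := (Set.Ici 0).indicator fun s => (Real.exp (-(lam * s)) : ℂ)
  have hfm : AEStronglyMeasurable f volume := by
    refine (Continuous.aestronglyMeasurable ?_).indicator measurableSet_Ici
    fun_prop
  have hf : MemLp f 2 volume := by
    rw [memLp_two_iff_integrable_sq_norm hfm]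
    have h : Integrable ((Set.Ici 0).indicator fun s => Real.exp (-(2 * lam) * s)) volume := by
      rw [integrable_indicator_iff measurableSet_Ici, integrableOn_Ici_iff_integrableOn_Ioi]
      exact exp_neg_integrableOn_Ioi 0 (by positivity)
    refine h.congr (ae_of_all _ fun s => ?_)
    by_cases hs : s ∈ Set.Ici (0 : ℝ)
    · simp only [f, Set.indicator_of_mem hs, Complex.norm_real, Real.norm_eq_abs,
        abs_of_pos (Real.exp_pos _), sq, ← Real.exp_add]
      ring_nf
    · simp [f, Set.indicator_of_notMem hs]
  refine ⟨hf.toLp f, ?_⟩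
  filter_upwards [hf.coeFn_toLp] with s hs h0
  rw [hs]
  exact Set.indicator_of_mem (Set.mem_Ici.2 h0) _

theorem coeFn_fold (k : Fin np ⊕ Fin nm) (w : L2R) :
    ∀ᵐ s, 0 ≤ s → (J k (P k w) : ℝ → ℂ) s = (w : ℝ → ℂ) s := by
  filter_upwards [ae_hasDerivAt_primCLM (J k (P k w)), ae_hasDerivAt_primCLM w,
    Measure.ae_ne volume (0 : ℝ)] with s h1 h2 hs0 hs
  refine h1.unique (h2.congr_of_eventuallyEq ?_)
  exact (lt_mem_nhds (lt_of_le_of_ne hs hs0.symm)).mono fun b hb => (hJP k).prim_fold w b hb.le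

/-- For every `v`, each `lam > 0` is an eigenvalue of the maximal operator, with boundary
values `(0, v)`. -/
theorem exists_eigenvector {lam : ℝ} (hlam : 0 < lam) {v : Fin nm → ℂ} (hv : v ≠ 0) :
    ∃ x : HSp δ, x ≠ 0 ∧ UnfoldedDom J x ((lam : ℂ) • x) (Sum.elim (fun _ => 0) v) := by
  obtain ⟨w, hw⟩ := exists_L2_exp hlam
  have hprim : ∀ b, 0 ≤ b → primCLM b w = ((1 - Real.exp (-(lam * b))) / lam : ℝ) := by
    intro b hb
    have h1 : primCLM b w = ∫ s in (0 : ℝ)..b, ((Real.exp (-(lam * s)) : ℝ) : ℂ) := by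
      rw [primCLM_apply]
      refine intervalIntegral.integral_congr_ae ?_
      filter_upwards [hw] with s hs hm
      rw [Set.uIoc_of_le hb] at hm
      exact hs hm.1.le
    have h2 : ∀ s, HasDerivAt (fun s => -(Real.exp (-(lam * s)) / lam))
        (Real.exp (-(lam * s))) s := fun s => by
      have := ((((hasDerivAt_id s).const_mul lam).neg.exp).div_const lam).neg
      refine this.congr_deriv ?_
      simp only [id_eq, Pi.neg_apply]
      field_simp
    rw [h1, intervalIntegral.integral_ofReal,
      intervalIntegral.integral_eq_sub_of_hasDerivAt (fun s _ => h2 s)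
        (Continuous.intervalIntegrable (by fun_prop) _ _)]
    congr 1
    simp only [mul_zero, neg_zero, Real.exp_zero]
    ring
  set x : HSp δ := WithLp.toLp 2 fun k => Sum.elim (fun _ => (0 : ℂ)) v k • P k w with hx
  have hxk : ∀ k, x k = Sum.elim (fun _ => (0 : ℂ)) v k • P k w := fun k => rfl
  have hxprim : ∀ k b, 0 ≤ b → primCLM b (J k (x k)) =
      Sum.elim (fun _ => (0 : ℂ)) v k * ((1 - Real.exp (-(lam * b))) / lam : ℝ) :=
    fun k b hb => by
      rw [hxk, map_smul, map_smul, (hJP k).prim_fold w b hb, hprim b hb, smul_eq_mul]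
  refine ⟨x, fun h0 => hv ?_, fun k => ?_⟩
  · ext j
    have := hxprim (.inr j) 1 zero_le_one
    rw [h0, PiLp.zero_apply, map_zero, map_zero, Sum.elim_inr, eq_comm, mul_eq_zero] at this
    refine this.resolve_right ?_
    have h1 : Real.exp (-(lam * 1)) < 1 := Real.exp_lt_one_iff.2 (by linarith)
    exact_mod_cast (div_pos (sub_pos.2 h1) hlam).ne'
  · have hsm : (J k (x k) : ℝ → ℂ) =ᵐ[volume]
        Sum.elim (fun _ => (0 : ℂ)) v k • (J k (P k w) : ℝ → ℂ) := by
      rw [hxk k, map_smul]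
      exact Lp.coeFn_smul _ _
    filter_upwards [hsm, coeFn_fold hJP k w, hw] with s h1 h2 h3 hs
    rw [h1, PiLp.smul_apply, map_smul, map_smul, hxprim k s hs, Pi.smul_apply, h2 hs, h3 hs]
    have hne : (lam : ℂ) ≠ 0 := by exact_mod_cast hlam.ne'
    cases k with
    | inl k => simp
    | inr j =>
      simp only [dirSign, Sum.elim_inr, smul_eq_mul]
      push_cast
      field_simp
      ring

end Generation

/-- The operator `A_Δ x = (Δ·x)'` with boundary condition
`K Θ(0)x₋(0) + Q Λ(0)x₊(0) = 0` generates a `C₀`-semigroup on `L²_{|Δ|}(0,∞)`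
if and only if `K` is invertible. -/
theorem stmt_18 {np nm : ℕ} (hnp : 1 ≤ np) (hnm : 1 ≤ nm)
    (δ : Fin np ⊕ Fin nm → ℝ → ℝ)
    (hcont : ∀ k, ContinuousOn (δ k) (Set.Ici 0))
    (hbdd : ∀ k, ∃ M : ℝ, ∀ ξ ∈ Set.Ici (0:ℝ), |δ k ξ| ≤ M)
    (hpos : ∀ k : Fin np, ∀ ξ ∈ Set.Ici (0:ℝ), 0 < δ (Sum.inl k) ξ)
    (hneg : ∀ j : Fin nm, ∀ ξ ∈ Set.Ici (0:ℝ), δ (Sum.inr j) ξ < 0)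
    (K : Matrix (Fin nm) (Fin nm) ℂ) (Q : Matrix (Fin nm) (Fin np) ℂ)
    (hrank : (Matrix.of fun i k => Sum.elim (Q i) (K i) k :
      Matrix (Fin nm) (Fin np ⊕ Fin nm) ℂ).rank = nm) :
    (∃ T : ℝ → HSp δ →L[ℂ] HSp δ,
      T 0 = ContinuousLinearMap.id ℂ (HSp δ) ∧
      (∀ s t : ℝ, 0 ≤ s → 0 ≤ t → T (t + s) = (T t).comp (T s)) ∧
      (∀ x : HSp δ, ContinuousOn (fun t => T t x) (Set.Ici 0)) ∧
      (∀ x : HSp δ,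
        (∃ L : HSp δ, Tendsto (fun t : ℝ => (t : ℂ)⁻¹ • (T t x - x))
            (𝓝[>] (0:ℝ)) (𝓝 L)) ↔
          ∃ y g, InDom δ K Q x y g) ∧
      (∀ x : HSp δ, ∀ y g, InDom δ K Q x y g →
        ∀ L : HSp δ, Tendsto (fun t : ℝ => (t : ℂ)⁻¹ • (T t x - x))
            (𝓝[>] (0:ℝ)) (𝓝 L) →
          ∀ k, (L k : ℝ → ℂ) =ᵐ[volume.restrict (Set.Ici 0)] g k)) ↔
    IsUnit K := by
  obtain ⟨J, P, hJP⟩ := exists_unfoldings δ hcont hbdd hpos hneg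
  constructor
  · rintro ⟨T, hT0, hTadd, hTcont, hTdom, hTgen⟩
    by_contra hK
    have hdet : K.det = 0 := by
      rwa [Matrix.isUnit_iff_isUnit_det, isUnit_iff_ne_zero, not_not] at hK
    obtain ⟨v, hv, hKv⟩ := Matrix.exists_mulVec_eq_zero_iff.2 hdet
    have hlam : 0 < ‖T 1‖ + 1 := by positivity
    obtain ⟨x, hx0, hx⟩ := exists_eigenvector hJP hlam hv
    obtain ⟨y, hy⟩ := exists_inDom_of_unfoldedDom (K := K) (Q := Q) hJP hx (by
      simp only [Sum.elim_inl, Sum.elim_inr, hKv, zero_add]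
      exact Q.mulVec_zero)
    obtain ⟨L, hL⟩ := (hTdom x).2 ⟨_, _, hy⟩
    obtain rfl := eq_of_ae_eq_restrict (hTgen x _ _ hy L hL)
    have h1 := semigroup_eigenvector T hT0 hTadd x (hTcont x) _ hL 1 zero_le_one
    have h2 := (T 1).le_opNorm x
    rw [h1, norm_smul, Complex.norm_real, Real.norm_eq_abs, abs_of_pos (Real.exp_pos _), mul_one] at h2
    have h3 := le_of_mul_le_mul_right h2 (norm_pos_iff.2 hx0)
    linarith [Real.add_one_le_exp (‖T 1‖ + 1)]
  · intro hK
    have hlim : ∀ x y g, InDom δ K Q x y g → ∃ L : HSp δ,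
        (∀ k, (L k : ℝ → ℂ) =ᵐ[volume.restrict (Set.Ici 0)] g k) ∧
        Tendsto (fun t : ℝ => (t : ℂ)⁻¹ • (shiftSemigroup J P (-(K⁻¹ * Q)) t x - x))
          (𝓝[>] (0 : ℝ)) (𝓝 L) := fun x y g h => by
      obtain ⟨L, hLg, hL⟩ := exists_unfoldedDom_of_inDom hJP h
      have hb := (boundary_iff (Q := Q) hK fun k => y k 0).1 h.2.2.2.2
      exact ⟨L, hLg, tendsto_of_unfoldedDom _ hJP hL hb⟩
    refine ⟨shiftSemigroup J P (-(K⁻¹ * Q)), shiftSemigroup_zero _ hJP,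
      fun s t hs ht => shiftSemigroup_add _ hJP hs ht,
      fun x => (continuous_shiftSemigroup J P _ x).continuousOn, fun x => ⟨?_, ?_⟩, ?_⟩
    · rintro ⟨L, hL⟩
      obtain ⟨c, hc, hbc⟩ := exists_unfoldedDom_of_tendsto _ hJP hL
      obtain ⟨y, hy⟩ := exists_inDom_of_unfoldedDom hJP hc ((boundary_iff hK c).2 hbc)
      exact ⟨_, _, hy⟩
    · rintro ⟨y, g, h⟩
      obtain ⟨L, -, hL⟩ := hlim x y g h
      exact ⟨L, hL⟩
    · intro x y g h L' hL' k
      obtain ⟨L, hLg, hL⟩ := hlim x y g h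
      rw [tendsto_nhds_unique hL' hL]
      exact hLg k
end
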